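/- arXiv:2407.03226 — 4 statements merged into one kernel-verified Lean document; each statement's English description precedes it below -/
import Mathlib

section
/- Let ξ be a real number such that 1, ξ, ξ², ξ³ are linearly independent over ℚ, let c > 0 and let λ > √2 − 1 satisfy: for every sufficiently large X there exists a non-zero x ∈ ℤ⁴ with |x₀| ≤ X and max_{1≤i≤3}|x₀ξⁱ − x_i| ≤ cX^{−λ}. Let (x_i)_{i≥1} be a sequence of minimal points for ξ in ℤ⁴, set X_i = ‖x_i‖, W_i = span_ℝ(x_{i−1}, x_i), I = {i ≥ 2 : W_i ≠ W_{i+1}}, U_i = W_i + W_{i+1} for i ∈ I, and J = {i ∈ I : U_i ≠ U_j where j is the successor of i in I}. Then, with θ = (1−λ)/λ, there exists a constant κ > 0 depending only on ξ, λ, c such that for each pair of consecutive elements i < j of I one has X_{j+1} ≤ κ·X_{i+1}^θ, and if moreover i ∈ J then X_i ≤ κ·X_j^{θ²−1}. -/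
noncomputable section

/-- ‖x‖ for an integer point of ℤ⁴, as a real number. -/
def znorm (x : Fin 4 → ℤ) : ℝ :=
  max (max |(x 0 : ℝ)| |(x 1 : ℝ)|) (max |(x 2 : ℝ)| |(x 3 : ℝ)|)

/-- L(x) = max_{1≤k≤3}|x₀ξᵏ − x_k| for an integer point of ℤ⁴. -/
def zL (ξ : ℝ) (x : Fin 4 → ℤ) : ℝ :=
  max (max |(x 0 : ℝ) * ξ - (x 1 : ℝ)| |(x 0 : ℝ) * ξ ^ 2 - (x 2 : ℝ)|)
    |(x 0 : ℝ) * ξ ^ 3 - (x 3 : ℝ)|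

/-- The approximation hypothesis. -/
def ApproxHyp (ξ c lam : ℝ) : Prop :=
  ∃ X₀ : ℝ, ∀ X : ℝ, X₀ ≤ X →
    ∃ x : Fin 4 → ℤ, x ≠ 0 ∧ |(x 0 : ℝ)| ≤ X ∧
      ∀ i : Fin 4, 1 ≤ (i : ℕ) →
        |(x 0 : ℝ) * ξ ^ (i : ℕ) - (x i : ℝ)| ≤ c * X ^ (-lam)

/-- A sequence of minimal points for ξ in ℤ⁴ (indexed from 1). -/
def IsMinimalSeq (ξ : ℝ) (x : ℕ → Fin 4 → ℤ) : Prop :=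
  (∀ i, 1 ≤ i → x i ≠ 0) ∧
  (∀ i, 1 ≤ i → znorm (x i) < znorm (x (i + 1))) ∧
  (∀ i, 1 ≤ i → zL ξ (x (i + 1)) < zL ξ (x i)) ∧
  (∀ i, 1 ≤ i → ∀ y : Fin 4 → ℤ, y ≠ 0 → zL ξ y < zL ξ (x i) →
    znorm (x (i + 1)) ≤ znorm y)

/-- The real vector attached to an integer point. -/
def rvec (x : Fin 4 → ℤ) : Fin 4 → ℝ := fun k => (x k : ℝ)

/-- W_i = span_ℝ(x_{i−1}, x_i). -/
def Wspace (x : ℕ → Fin 4 → ℤ) (i : ℕ) : Submodule ℝ (Fin 4 → ℝ) :=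
  Submodule.span ℝ {rvec (x (i - 1)), rvec (x i)}

/-- I = {i ≥ 2 : W_i ≠ W_{i+1}}. -/
def Iset (x : ℕ → Fin 4 → ℤ) : Set ℕ :=
  {i | 2 ≤ i ∧ Wspace x i ≠ Wspace x (i + 1)}

/-- U_i = W_i + W_{i+1}. -/
def Uspace (x : ℕ → Fin 4 → ℤ) (i : ℕ) : Submodule ℝ (Fin 4 → ℝ) :=
  Wspace x i ⊔ Wspace x (i + 1)

/-- i < j are consecutive elements of S (j is the successor of i in S). -/
def ConsecIn (S : Set ℕ) (i j : ℕ) : Prop :=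
  i ∈ S ∧ j ∈ S ∧ i < j ∧ ∀ k ∈ S, i < k → j ≤ k

/-- J = {i ∈ I : U_i ≠ U_j where j is the successor of i in I}. -/
def Jset (x : ℕ → Fin 4 → ℤ) : Set ℕ :=
  {i | i ∈ Iset x ∧ ∀ j, ConsecIn (Iset x) i j → Uspace x i ≠ Uspace x j}

/-! ### Elementary bounds -/

lemma abs_coord_le_znorm (x : Fin 4 → ℤ) (k : Fin 4) : |(x k : ℝ)| ≤ znorm x := by
  fin_cases k <;> simp [znorm]

lemma zL_nonneg (ξ : ℝ) (x : Fin 4 → ℤ) : 0 ≤ zL ξ x :=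
  (abs_nonneg _).trans (le_max_right _ _)

lemma abs_sub_coord_le_zL (ξ : ℝ) (x : Fin 4 → ℤ) (k : Fin 4) :
    |(x 0 : ℝ) * ξ ^ (k : ℕ) - x k| ≤ zL ξ x := by
  fin_cases k
  · simpa using zL_nonneg ξ x
  all_goals simp [zL]

lemma znorm_le {x : Fin 4 → ℤ} {B : ℝ} (h : ∀ k, |(x k : ℝ)| ≤ B) : znorm x ≤ B := by
  simp only [znorm, max_le_iff]
  exact ⟨⟨h 0, h 1⟩, h 2, h 3⟩

lemma zL_le {ξ B : ℝ} {x : Fin 4 → ℤ} (h : ∀ k : Fin 4, |(x 0 : ℝ) * ξ ^ (k : ℕ) - x k| ≤ B) :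
    zL ξ x ≤ B := by
  have h1 := h 1
  have h2 := h 2
  have h3 := h 3
  simp only [zL, max_le_iff]
  simp only [Fin.val_one, pow_one] at h1
  exact ⟨⟨h1, h2⟩, h3⟩

lemma one_le_znorm {x : Fin 4 → ℤ} (hx : x ≠ 0) : 1 ≤ znorm x := by
  obtain ⟨k, hk⟩ := Function.ne_iff.mp hx
  refine le_trans ?_ (abs_coord_le_znorm x k)
  exact_mod_cast Int.one_le_abs hk

/-- An upper bound for `1` and the absolute values of `ξ`, `ξ²`, `ξ³`. -/
def powBound (ξ : ℝ) : ℝ := 1 + |ξ| + |ξ| ^ 2 + |ξ| ^ 3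

lemma one_le_powBound (ξ : ℝ) : 1 ≤ powBound ξ := by
  unfold powBound
  have := abs_nonneg ξ
  nlinarith [pow_nonneg this 2, pow_nonneg this 3]

lemma abs_pow_le_powBound (ξ : ℝ) (k : Fin 4) : |ξ ^ (k : ℕ)| ≤ powBound ξ := by
  have h := abs_nonneg ξ
  have h2 := pow_nonneg h 2
  have h3 := pow_nonneg h 3
  rw [abs_pow]
  unfold powBound
  fin_cases k <;> simp <;> nlinarith

lemma abs_le_powBound (ξ : ℝ) : |ξ| ≤ powBound ξ := by
  simpa using abs_pow_le_powBound ξ 1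

lemma abs_coord_le (ξ : ℝ) (x : Fin 4 → ℤ) (k : Fin 4) :
    |(x k : ℝ)| ≤ powBound ξ * |(x 0 : ℝ)| + zL ξ x := by
  have h1 := abs_sub_coord_le_zL ξ x k
  have h2 : |(x 0 : ℝ) * ξ ^ (k : ℕ)| ≤ powBound ξ * |(x 0 : ℝ)| := by
    rw [abs_mul, mul_comm]
    exact mul_le_mul_of_nonneg_right (abs_pow_le_powBound ξ k) (abs_nonneg _)
  calc |(x k : ℝ)| = |(x 0 : ℝ) * ξ ^ (k : ℕ) - ((x 0 : ℝ) * ξ ^ (k : ℕ) - x k)| := by ring_nf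
    _ ≤ _ := (abs_sub _ _).trans (add_le_add h2 h1)

lemma znorm_le_powBound_mul (ξ : ℝ) (x : Fin 4 → ℤ) :
    znorm x ≤ powBound ξ * |(x 0 : ℝ)| + zL ξ x :=
  znorm_le (abs_coord_le ξ x)

lemma coord_zero_ne_zero {ξ : ℝ} {x : Fin 4 → ℤ} (hx : x ≠ 0) (hL : zL ξ x < 1) : x 0 ≠ 0 := by
  intro h0
  have h1 := one_le_znorm hx
  have h2 := znorm_le_powBound_mul ξ x
  simp only [h0, Int.cast_zero, abs_zero, mul_zero, zero_add] at h2
  linarith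

lemma znorm_le_two_powBound_mul {ξ : ℝ} {x : Fin 4 → ℤ} (hx : x ≠ 0) (hL : zL ξ x < 1) :
    znorm x ≤ 2 * powBound ξ * |(x 0 : ℝ)| := by
  have h0 : (1 : ℝ) ≤ |(x 0 : ℝ)| := by
    exact_mod_cast Int.one_le_abs (coord_zero_ne_zero hx hL)
  nlinarith [znorm_le_powBound_mul ξ x, one_le_powBound ξ]

lemma abs_shift_le (ξ : ℝ) (x : Fin 4 → ℤ) (k : Fin 3) :
    |ξ * (x k.castSucc : ℝ) - x k.succ| ≤ 2 * powBound ξ * zL ξ x := by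
  have h1 := abs_sub_coord_le_zL ξ x k.succ
  have h2 := abs_sub_coord_le_zL ξ x k.castSucc
  have h3 : |ξ * ((x 0 : ℝ) * ξ ^ (k.castSucc : ℕ) - x k.castSucc)| ≤ powBound ξ * zL ξ x := by
    rw [abs_mul]
    exact mul_le_mul (abs_le_powBound ξ) h2 (abs_nonneg _) (by linarith [one_le_powBound ξ])
  calc |ξ * (x k.castSucc : ℝ) - x k.succ|
      = |((x 0 : ℝ) * ξ ^ (k.succ : ℕ) - x k.succ)
          - ξ * ((x 0 : ℝ) * ξ ^ (k.castSucc : ℕ) - x k.castSucc)| := by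
        congr 1
        simp only [Fin.val_succ, Fin.val_castSucc]
        ring
    _ ≤ zL ξ x + powBound ξ * zL ξ x := (abs_sub _ _).trans (add_le_add h1 h3)
    _ ≤ _ := by nlinarith [zL_nonneg ξ x, one_le_powBound ξ]

/-- The Plücker coordinates of a pair of integer points. -/
def plucker (x y : Fin 4 → ℤ) (k l : Fin 4) : ℤ := x k * y l - x l * y k

lemma abs_plucker_le {ξ : ℝ} {x y : Fin 4 → ℤ} (hX : znorm x ≤ znorm y)
    (hL : zL ξ y ≤ zL ξ x) (k l : Fin 4) :
    |(plucker x y k l : ℝ)| ≤ 4 * powBound ξ * (znorm y * zL ξ x) := by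
  have hK := one_le_powBound ξ
  have hY : 0 ≤ znorm y := (abs_nonneg _).trans (abs_coord_le_znorm y 0)
  have hLx := zL_nonneg ξ x
  have hLy := zL_nonneg ξ y
  have key : ∀ a b : Fin 4, |ξ ^ (a : ℕ) * ((x 0 : ℝ) * ((y 0 : ℝ) * ξ ^ (b : ℕ) - y b))| ≤
      powBound ξ * (znorm y * zL ξ x) := by
    intro a b
    rw [abs_mul, abs_mul]
    gcongr
    · exact abs_pow_le_powBound ξ a
    · exact (abs_coord_le_znorm x 0).trans hX
    · exact (abs_sub_coord_le_zL ξ y b).trans hL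
  have key2 : ∀ a b : Fin 4, |((x 0 : ℝ) * ξ ^ (a : ℕ) - x a) * (y b : ℝ)| ≤
      powBound ξ * (znorm y * zL ξ x) := by
    intro a b
    rw [abs_mul]
    calc _ ≤ zL ξ x * znorm y := by
          gcongr
          · exact abs_sub_coord_le_zL ξ x a
          · exact abs_coord_le_znorm y b
      _ ≤ _ := by nlinarith [mul_nonneg hY hLx]
  have e : (plucker x y k l : ℝ) =
      (ξ ^ (l : ℕ) * ((x 0 : ℝ) * ((y 0 : ℝ) * ξ ^ (k : ℕ) - y k)) -
        ξ ^ (k : ℕ) * ((x 0 : ℝ) * ((y 0 : ℝ) * ξ ^ (l : ℕ) - y l))) +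
      (((x 0 : ℝ) * ξ ^ (l : ℕ) - x l) * (y k : ℝ) -
        ((x 0 : ℝ) * ξ ^ (k : ℕ) - x k) * (y l : ℝ)) := by
    simp only [plucker]
    push_cast
    ring
  rw [e]
  have a1 := key l k
  have a2 := key k l
  have a3 := key2 l k
  have a4 := key2 k l
  rw [abs_le] at *
  constructor <;> linarith [a1.1, a1.2, a2.1, a2.2, a3.1, a3.2, a4.1, a4.2]

/-- Two integer points, of which the larger is the better approximation, are not collinear. -/
lemma exists_plucker_ne_zero {ξ : ℝ} {x y : Fin 4 → ℤ} (hx : x ≠ 0) (hX : znorm x < znorm y)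
    (hL : zL ξ y < zL ξ x) : ∃ k l, plucker x y k l ≠ 0 := by
  by_contra! h
  obtain ⟨k, hk⟩ := Function.ne_iff.mp hx
  have hk' : (0 : ℝ) < |(x k : ℝ)| := by
    have : (x k : ℝ) ≠ 0 := by exact_mod_cast hk
    exact abs_pos.mpr this
  have e : ∀ l, (x k : ℝ) * y l = y k * x l := by
    intro l
    have := h k l
    simp only [plucker] at this
    have h2 : x k * y l = y k * x l := by linarith
    exact_mod_cast h2
  have hyk : |(x k : ℝ)| < |(y k : ℝ)| := by
    by_contra! hle
    have : znorm y ≤ znorm x := by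
      refine znorm_le fun l => ?_
      have h3 : |(x k : ℝ)| * |(y l : ℝ)| = |(y k : ℝ)| * |(x l : ℝ)| := by
        rw [← abs_mul, ← abs_mul, e l]
      have h4 : |(x k : ℝ)| * |(y l : ℝ)| ≤ |(x k : ℝ)| * |(x l : ℝ)| := by
        rw [h3]; gcongr
      exact (le_of_mul_le_mul_left h4 hk').trans (abs_coord_le_znorm x l)
    linarith
  have hle : zL ξ x ≤ zL ξ y := by
    have h5 : ∀ l : Fin 4, |(x 0 : ℝ) * ξ ^ (l : ℕ) - x l| ≤ zL ξ y := by
      intro l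
      refine le_trans ?_ (abs_sub_coord_le_zL ξ y l)
      have h3 : |(x k : ℝ)| * |(y 0 : ℝ) * ξ ^ (l : ℕ) - y l| =
          |(y k : ℝ)| * |(x 0 : ℝ) * ξ ^ (l : ℕ) - x l| := by
        rw [← abs_mul, ← abs_mul]
        congr 1
        linear_combination ξ ^ (l : ℕ) * e 0 - e l
      have h4 : |(x k : ℝ)| * |(x 0 : ℝ) * ξ ^ (l : ℕ) - x l| ≤
          |(x k : ℝ)| * |(y 0 : ℝ) * ξ ^ (l : ℕ) - y l| := by
        rw [h3]; gcongr
      exact le_of_mul_le_mul_left h4 hk'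
    exact zL_le h5
  linarith

/-! ### Recurrence relations of order two -/

/-- The integer point `x` satisfies the recurrence relation with coefficients `a`. -/
def Recurs (a : Fin 3 → ℤ) (x : Fin 4 → ℤ) : Prop :=
  a 0 * x 0 + a 1 * x 1 + a 2 * x 2 = 0 ∧ a 0 * x 1 + a 1 * x 2 + a 2 * x 3 = 0

/-- The cross product of `(x₀, x₁, x₂)` and `(x₁, x₂, x₃)`. -/
def hankelCross (x : Fin 4 → ℤ) : Fin 3 → ℤ :=
  ![x 1 * x 3 - x 2 * x 2, x 2 * x 1 - x 0 * x 3, x 0 * x 2 - x 1 * x 1]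

lemma recurs_hankelCross_self (x : Fin 4 → ℤ) : Recurs (hankelCross x) x := by
  simp only [Recurs, hankelCross, Matrix.cons_val]
  constructor <;> ring

lemma abs_combination_le {p q r a b c N M : ℝ} (hp : |p| ≤ N) (hq : |q| ≤ N) (hr : |r| ≤ N)
    (ha : |a| ≤ M) (hb : |b| ≤ M) (hc : |c| ≤ M) : |p * a - q * b + r * c| ≤ 3 * (N * M) := by
  have hN : 0 ≤ N := (abs_nonneg _).trans hp
  have h1 : |p * a| ≤ N * M := by rw [abs_mul]; gcongr
  have h2 : |q * b| ≤ N * M := by rw [abs_mul]; gcongr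
  have h3 : |r * c| ≤ N * M := by rw [abs_mul]; gcongr
  rw [abs_le] at *
  constructor <;> linarith [h1.1, h1.2, h2.1, h2.2, h3.1, h3.2]

/-- If `x` lies in the span of `u` and `v`, then either the recurrence attached to `x` holds for
both `u` and `v`, or the Plücker coordinates of `u, v` cannot be too small. -/
lemma recurs_or_le {ξ N : ℝ} {u v x : Fin 4 → ℤ} {α β : ℝ}
    (hx : ∀ k, (x k : ℝ) = α * u k + β * v k)
    (hN : ∀ k l, |(plucker u v k l : ℝ)| ≤ N) :
    (Recurs (hankelCross x) u ∧ Recurs (hankelCross x) v) ∨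
      min 1 |ξ| ≤ 6 * powBound ξ * (N * zL ξ x) := by
  have s0 : |ξ * (x 0 : ℝ) - x 1| ≤ 2 * powBound ξ * zL ξ x := abs_shift_le ξ x 0
  have s1 : |ξ * (x 1 : ℝ) - x 2| ≤ 2 * powBound ξ * zL ξ x := abs_shift_le ξ x 1
  have s2 : |ξ * (x 2 : ℝ) - x 3| ≤ 2 * powBound ξ * zL ξ x := abs_shift_le ξ x 2
  by_cases h1 : plucker u v 1 2 * x 1 - plucker u v 0 2 * x 2 + plucker u v 0 1 * x 3 = 0
  · by_cases h2 : plucker u v 2 3 * x 0 - plucker u v 1 3 * x 1 + plucker u v 1 2 * x 2 = 0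
    · left
      have h1' : ((plucker u v 1 2 : ℝ)) * x 1 - plucker u v 0 2 * x 2 + plucker u v 0 1 * x 3
        = 0 := by exact_mod_cast h1
      have h2' : ((plucker u v 2 3 : ℝ)) * x 0 - plucker u v 1 3 * x 1 + plucker u v 1 2 * x 2
        = 0 := by exact_mod_cast h2
      simp only [plucker] at h1' h2'
      push_cast at h1' h2'
      simp only [Recurs, hankelCross, Matrix.cons_val]
      simp only [hx] at h1' h2'
      refine ⟨⟨?_, ?_⟩, ⟨?_, ?_⟩⟩
      all_goals
        rify
        simp only [hx]
      · linear_combination β * h1'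
      · linear_combination (-β) * h2'
      · linear_combination (-α) * h1'
      · linear_combination α * h2'
    · right
      have hz : (plucker u v 2 3 : ℝ) * x 1 - plucker u v 1 3 * x 2 + plucker u v 1 2 * x 3 = 0 := by
        simp only [plucker, hx]
        push_cast
        ring
      have hD : (1 : ℝ) ≤ |(plucker u v 2 3 : ℝ) * x 0 - plucker u v 1 3 * x 1
          + plucker u v 1 2 * x 2| := by exact_mod_cast Int.one_le_abs h2
      have hb := abs_combination_le (hN 2 3) (hN 1 3) (hN 1 2) s0 s1 s2
      have e : ξ * ((plucker u v 2 3 : ℝ) * x 0 - plucker u v 1 3 * x 1 + plucker u v 1 2 * x 2) =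
          (plucker u v 2 3 : ℝ) * (ξ * x 0 - x 1) - plucker u v 1 3 * (ξ * x 1 - x 2)
            + plucker u v 1 2 * (ξ * x 2 - x 3) := by linear_combination hz
      rw [← e, abs_mul] at hb
      have := min_le_right 1 |ξ|
      nlinarith [abs_nonneg ξ]
  · right
    have hz : (plucker u v 1 2 : ℝ) * x 0 - plucker u v 0 2 * x 1 + plucker u v 0 1 * x 2 = 0 := by
      simp only [plucker, hx]
      push_cast
      ring
    have hD : (1 : ℝ) ≤ |(plucker u v 1 2 : ℝ) * x 1 - plucker u v 0 2 * x 2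
        + plucker u v 0 1 * x 3| := by exact_mod_cast Int.one_le_abs h1
    have hb := abs_combination_le (hN 1 2) (hN 0 2) (hN 0 1) s0 s1 s2
    have e : -((plucker u v 1 2 : ℝ) * x 1 - plucker u v 0 2 * x 2 + plucker u v 0 1 * x 3) =
        (plucker u v 1 2 : ℝ) * (ξ * x 0 - x 1) - plucker u v 0 2 * (ξ * x 1 - x 2)
          + plucker u v 0 1 * (ξ * x 2 - x 3) := by linear_combination (-ξ) * hz
    rw [← e, abs_neg] at hb
    have := min_le_left 1 |ξ|
    linarith

lemma exists_primitive {a : Fin 3 → ℤ} (ha : a ≠ 0) :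
    ∃ (g : ℤ) (b c : Fin 3 → ℤ), g ≠ 0 ∧ (∀ k, a k = g * b k) ∧ ∑ k, c k * b k = 1 := by
  obtain ⟨g, hg⟩ := (IsPrincipalIdealRing.principal (Ideal.span (Set.range a))).principal
  have hdvd : ∀ k, ∃ b, a k = g * b := by
    intro k
    have h1 : a k ∈ Ideal.span (Set.range a) := Ideal.subset_span ⟨k, rfl⟩
    rw [hg] at h1
    exact Ideal.mem_span_singleton.mp h1
  choose b hb using hdvd
  have hmem : g ∈ Ideal.span (Set.range a) := by
    rw [hg]
    exact Ideal.mem_span_singleton_self g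
  obtain ⟨c, hc⟩ := Ideal.mem_span_range_iff_exists_fun.mp hmem
  have hg0 : g ≠ 0 := by
    rintro rfl
    exact ha (funext fun k => by simp [hb k])
  refine ⟨g, b, c, hg0, hb, mul_left_cancel₀ hg0 ?_⟩
  rw [Finset.mul_sum, mul_one]
  refine Eq.trans (Finset.sum_congr rfl fun k _ => ?_) hc
  rw [hb k]
  ring

/-- A recurrence relation satisfied by two independent integer points is proportional to one whose
coefficients are at most the square root of the Plücker coordinates. -/
lemma exists_recurs_sq_le {a : Fin 3 → ℤ} {u v : Fin 4 → ℤ} {N : ℝ} (ha : a ≠ 0)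
    (hu : Recurs a u) (hv : Recurs a v) (huv : ∃ k l, plucker u v k l ≠ 0)
    (hN : ∀ k l, |(plucker u v k l : ℝ)| ≤ N) :
    ∃ b : Fin 3 → ℤ, b ≠ 0 ∧ (∀ w, Recurs b w ↔ Recurs a w) ∧ ∀ k, (b k : ℝ) ^ 2 ≤ 2 * N := by
  obtain ⟨g, b, c, hg, hab, hc⟩ := exists_primitive ha
  have hiff : ∀ w, Recurs b w ↔ Recurs a w := by
    intro w
    have h1 : ∀ s t r : ℤ, a 0 * s + a 1 * t + a 2 * r = g * (b 0 * s + b 1 * t + b 2 * r) := by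
      intro s t r
      rw [hab 0, hab 1, hab 2]
      ring
    simp only [Recurs, h1, mul_eq_zero, hg, false_or]
  have hb : b ≠ 0 := by
    rintro rfl
    simp at hc
  refine ⟨b, hb, hiff, ?_⟩
  obtain ⟨e1, e2⟩ := (hiff u).mpr hu
  obtain ⟨f1, f2⟩ := (hiff v).mpr hv
  rw [Fin.sum_univ_three] at hc
  have R1 : ∀ l, b 0 * plucker u v 0 l + b 1 * plucker u v 1 l + b 2 * plucker u v 2 l = 0 := by
    intro l
    simp only [plucker]
    linear_combination v l * e1 - u l * f1
  have R2 : ∀ l, b 0 * plucker u v 1 l + b 1 * plucker u v 2 l + b 2 * plucker u v 3 l = 0 := by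
    intro l
    simp only [plucker]
    linear_combination v l * e2 - u l * f2
  have antisymm : ∀ k l, plucker u v l k = -plucker u v k l := by
    intro k l
    simp only [plucker]
    ring
  have diag : ∀ k, plucker u v k k = 0 := by
    intro k
    simp only [plucker]
    ring
  have A0 := R1 0
  have A1 := R1 1
  have A2 := R1 2
  have A3 := R1 3
  have B0 := R2 0
  have B1 := R2 1
  have B2 := R2 2
  have B3 := R2 3
  simp only [diag, antisymm 0 1, antisymm 0 2, antisymm 0 3, antisymm 1 2, antisymm 1 3,
    antisymm 2 3] at A0 A1 A2 A3 B0 B1 B2 B3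
  generalize hp01 : plucker u v 0 1 = p01 at *
  generalize hp02 : plucker u v 0 2 = p02 at *
  generalize hp03 : plucker u v 0 3 = p03 at *
  generalize hp12 : plucker u v 1 2 = p12 at *
  generalize hp13 : plucker u v 1 3 = p13 at *
  generalize hp23 : plucker u v 2 3 = p23 at *
  obtain ⟨s0, hs0⟩ : ∃ s, s = c 0 * p23 - c 1 * p13 + c 2 * p12 := ⟨_, rfl⟩
  obtain ⟨s1, hs1⟩ : ∃ s, s = -c 0 * p13 + c 1 * (p03 + p12) - c 2 * p02 := ⟨_, rfl⟩
  obtain ⟨s2, hs2⟩ : ∃ s, s = c 0 * p12 - c 1 * p02 + c 2 * p01 := ⟨_, rfl⟩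
  have q00 : p23 = s0 * b 0 := by
    rw [hs0]; linear_combination (-p23) * hc + c 1 * B3 - c 2 * B2
  have q10 : -p13 = s0 * b 1 := by
    rw [hs0]; linear_combination p13 * hc - c 0 * B3 + c 2 * B1
  have q20 : p12 = s0 * b 2 := by
    rw [hs0]; linear_combination (-p12) * hc + c 0 * B2 - c 1 * B1
  have q01 : -p13 = s1 * b 0 := by
    rw [hs1]; linear_combination p13 * hc + c 1 * (-A3 - B2) + c 2 * (A2 + B1)
  have q11 : p03 + p12 = s1 * b 1 := by
    rw [hs1]; linear_combination (-(p03 + p12)) * hc - c 0 * (-A3 - B2) - c 2 * (B0 + A1)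
  have q21 : -p02 = s1 * b 2 := by
    rw [hs1]; linear_combination p02 * hc - c 0 * (A2 + B1) + c 1 * (B0 + A1)
  have q02 : p12 = s2 * b 0 := by
    rw [hs2]; linear_combination (-p12) * hc + c 1 * A2 - c 2 * A1
  have q12 : -p02 = s2 * b 1 := by
    rw [hs2]; linear_combination p02 * hc - c 0 * A2 + c 2 * A0
  have q22 : p01 = s2 * b 2 := by
    rw [hs2]; linear_combination (-p01) * hc + c 0 * A1 - c 1 * A0
  obtain ⟨r, hr⟩ : ∃ r, r = c 0 * s0 + c 1 * s1 + c 2 * s2 := ⟨_, rfl⟩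
  have t0 : s0 = r * b 0 := by
    rw [hr]; linear_combination (-s0) * hc + c 1 * (q01 - q10) + c 2 * (q02 - q20)
  have t1 : s1 = r * b 1 := by
    rw [hr]; linear_combination (-s1) * hc + c 0 * (q10 - q01) + c 2 * (q12 - q21)
  have t2 : s2 = r * b 2 := by
    rw [hr]; linear_combination (-s2) * hc + c 0 * (q20 - q02) + c 1 * (q21 - q12)
  have hr0 : r ≠ 0 := by
    intro h0
    rw [h0, zero_mul] at t0 t1 t2
    rw [t0, zero_mul] at q00 q10 q20
    rw [t1, zero_mul] at q11 q21
    rw [t2, zero_mul] at q22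
    have z : ∀ k l, plucker u v k l = 0 := by
      intro k l
      fin_cases k <;> fin_cases l <;> simp <;>
        first
        | exact diag _
        | omega
        | (rw [antisymm]; omega)
    obtain ⟨k, l, hkl⟩ := huv
    exact hkl (z k l)
  have hr1 : (1 : ℝ) ≤ |(r : ℝ)| := by exact_mod_cast Int.one_le_abs hr0
  have fin : ∀ t q : ℝ, q = r * t * t → |q| ≤ 2 * N → t ^ 2 ≤ 2 * N := by
    intro t q hq hqN
    have : |q| = |(r : ℝ)| * t ^ 2 := by
      rw [hq, mul_assoc, abs_mul, ← sq, abs_of_nonneg (sq_nonneg t)]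
    nlinarith [sq_nonneg t]
  have n23 := hN 2 3
  have n03 := hN 0 3
  have n12 := hN 1 2
  have n01 := hN 0 1
  rw [hp23] at n23
  rw [hp03] at n03
  rw [hp12] at n12
  rw [hp01] at n01
  have n11 : |((p03 + p12 : ℤ) : ℝ)| ≤ 2 * N := by
    push_cast
    linarith [abs_add_le (p03 : ℝ) p12]
  have hNn : 0 ≤ N := (abs_nonneg _).trans n01
  intro k
  fin_cases k
  · exact fin _ p23 (by rw [q00, t0]; push_cast; ring) (by linarith)
  · exact fin _ ((p03 + p12 : ℤ)) (by rw [q11, t1]; push_cast; ring) n11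
  · exact fin _ p01 (by rw [q22, t2]; push_cast; ring) (by linarith)

lemma abs_eval_mul_le {ξ A : ℝ} {a : Fin 3 → ℤ} {x : Fin 4 → ℤ} (hA : ∀ k, |(a k : ℝ)| ≤ A)
    (hx : Recurs a x) :
    |(a 0 + a 1 * ξ + a 2 * ξ ^ 2 : ℝ)| * |(x 0 : ℝ)| ≤ 3 * (A * zL ξ x) := by
  have h : (a 0 * x 0 + a 1 * x 1 + a 2 * x 2 : ℝ) = 0 := by exact_mod_cast hx.1
  have hb := abs_combination_le (hA 0) ((abs_neg _).trans_le (hA 1)) (hA 2)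
    (abs_sub_coord_le_zL ξ x 0) (abs_sub_coord_le_zL ξ x 1) (abs_sub_coord_le_zL ξ x 2)
  rw [← abs_mul]
  refine le_of_eq_of_le ?_ hb
  congr 1
  simp
  linear_combination h

lemma one_le_of_not_recurs {ξ A : ℝ} {a : Fin 3 → ℤ} {z : Fin 4 → ℤ} (hA : ∀ k, |(a k : ℝ)| ≤ A)
    (hz : ¬ Recurs a z) :
    1 ≤ powBound ξ * (|(a 0 + a 1 * ξ + a 2 * ξ ^ 2 : ℝ)| * |(z 0 : ℝ)|) + 3 * (A * zL ξ z) := by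
  have hK := one_le_powBound ξ
  have hE : 0 ≤ |(a 0 + a 1 * ξ + a 2 * ξ ^ 2 : ℝ)| * |(z 0 : ℝ)| := by positivity
  rw [Recurs, not_and_or] at hz
  rcases hz with hz | hz
  · have hD : (1 : ℝ) ≤ |(a 0 * z 0 + a 1 * z 1 + a 2 * z 2 : ℝ)| := by
      exact_mod_cast Int.one_le_abs hz
    have hb := abs_combination_le (hA 0) ((abs_neg _).trans_le (hA 1)) (hA 2)
      (abs_sub_coord_le_zL ξ z 0) (abs_sub_coord_le_zL ξ z 1) (abs_sub_coord_le_zL ξ z 2)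
    have e : (a 0 * z 0 + a 1 * z 1 + a 2 * z 2 : ℝ) =
        (a 0 + a 1 * ξ + a 2 * ξ ^ 2 : ℝ) * z 0 -
        ((a 0 : ℝ) * ((z 0 : ℝ) * ξ ^ ((0 : Fin 4) : ℕ) - z 0)
          - (-(a 1 : ℝ)) * ((z 0 : ℝ) * ξ ^ ((1 : Fin 4) : ℕ) - z 1)
          + (a 2 : ℝ) * ((z 0 : ℝ) * ξ ^ ((2 : Fin 4) : ℕ) - z 2)) := by
      simp
      ring
    rw [e] at hD
    have h2 := hD.trans (abs_sub _ _)
    rw [abs_mul] at h2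
    nlinarith
  · have hD : (1 : ℝ) ≤ |(a 0 * z 1 + a 1 * z 2 + a 2 * z 3 : ℝ)| := by
      exact_mod_cast Int.one_le_abs hz
    have hb := abs_combination_le (hA 0) ((abs_neg _).trans_le (hA 1)) (hA 2)
      (abs_sub_coord_le_zL ξ z 1) (abs_sub_coord_le_zL ξ z 2) (abs_sub_coord_le_zL ξ z 3)
    have e : (a 0 * z 1 + a 1 * z 2 + a 2 * z 3 : ℝ) =
        ξ * ((a 0 + a 1 * ξ + a 2 * ξ ^ 2 : ℝ) * z 0) -
        ((a 0 : ℝ) * ((z 0 : ℝ) * ξ ^ ((1 : Fin 4) : ℕ) - z 1)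
          - (-(a 1 : ℝ)) * ((z 0 : ℝ) * ξ ^ ((2 : Fin 4) : ℕ) - z 2)
          + (a 2 : ℝ) * ((z 0 : ℝ) * ξ ^ ((3 : Fin 4) : ℕ) - z 3)) := by
      have h2 : ((2 : Fin 4) : ℕ) = 2 := rfl
      have h3 : ((3 : Fin 4) : ℕ) = 3 := rfl
      rw [h2, h3, Fin.val_one]
      ring
    rw [e] at hD
    have h2 := hD.trans (abs_sub _ _)
    rw [abs_mul, abs_mul] at h2
    nlinarith [mul_le_mul_of_nonneg_right (abs_le_powBound ξ) hE]

/-- If the recurrence `a` holds for `x` but not for the shorter point `z`, then the coefficients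
of `a` cannot be too small. -/
lemma one_le_coeff_mul {ξ A : ℝ} {a : Fin 3 → ℤ} {x z : Fin 4 → ℤ} (hA : ∀ k, |(a k : ℝ)| ≤ A)
    (hx : Recurs a x) (hz : ¬ Recurs a z) (hx0 : x ≠ 0) (hx1 : zL ξ x < 1)
    (hX : znorm z ≤ znorm x) (hL : zL ξ x ≤ zL ξ z) :
    1 ≤ 9 * powBound ξ ^ 2 * (A * zL ξ z) := by
  have hK := one_le_powBound ξ
  have hA0 : 0 ≤ A := (abs_nonneg _).trans (hA 0)
  have h1 := abs_eval_mul_le hA hx (ξ := ξ)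
  have h2 := one_le_of_not_recurs hA hz (ξ := ξ)
  have h3 := ((abs_coord_le_znorm z 0).trans hX).trans (znorm_le_two_powBound_mul hx0 hx1)
  have hE : 0 ≤ |(a 0 + a 1 * ξ + a 2 * ξ ^ 2 : ℝ)| := abs_nonneg _
  generalize |(a 0 + a 1 * ξ + a 2 * ξ ^ 2 : ℝ)| = E at *
  generalize powBound ξ = K at *
  have h4 : E * |(z 0 : ℝ)| ≤ 2 * K * (E * |(x 0 : ℝ)|) := by nlinarith
  have h5 : A * zL ξ x ≤ A * zL ξ z := by gcongr
  have h6 : 0 ≤ A * zL ξ z := mul_nonneg hA0 (zL_nonneg ξ z)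
  have h7 : K * (E * |(z 0 : ℝ)|) ≤ K * (2 * K * (3 * (A * zL ξ z))) :=
    mul_le_mul_of_nonneg_left (h4.trans (mul_le_mul_of_nonneg_left (by linarith) (by linarith)))
      (by linarith)
  nlinarith [mul_nonneg (mul_nonneg (sub_nonneg.2 hK) (sub_nonneg.2 hK)) h6,
    mul_nonneg (sub_nonneg.2 hK) h6]

/-- Recurrence relations satisfied by a point that is not a geometric progression are all
proportional. -/
lemma Recurs.of_hankelCross {a : Fin 3 → ℤ} {x z : Fin 4 → ℤ} (hx : hankelCross x ≠ 0)
    (ha : Recurs a x) (hz : Recurs (hankelCross x) z) : Recurs a z := by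
  obtain ⟨h1, h2⟩ := ha
  obtain ⟨k, hk⟩ := Function.ne_iff.mp hx
  have e01 : hankelCross x 0 * a 1 = hankelCross x 1 * a 0 := by
    simp only [hankelCross, Matrix.cons_val]
    linear_combination x 3 * h1 - x 2 * h2
  have e02 : hankelCross x 0 * a 2 = hankelCross x 2 * a 0 := by
    simp only [hankelCross, Matrix.cons_val]
    linear_combination x 1 * h2 - x 2 * h1
  have e12 : hankelCross x 1 * a 2 = hankelCross x 2 * a 1 := by
    simp only [hankelCross, Matrix.cons_val]
    linear_combination x 1 * h1 - x 0 * h2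
  have e : ∀ l, hankelCross x k * a l = a k * hankelCross x l := by
    intro l
    fin_cases k <;> fin_cases l <;> simp only [Fin.zero_eta, Fin.mk_one, Fin.reduceFinMk] <;>
      linarith
  refine ⟨mul_left_cancel₀ hk ?_, mul_left_cancel₀ hk ?_⟩
  · linear_combination a k * hz.1 + z 0 * e 0 + z 1 * e 1 + z 2 * e 2
  · linear_combination a k * hz.2 + z 1 * e 0 + z 2 * e 1 + z 3 * e 2

/-- A geometric progression that follows an independent shorter point is not a good
approximation. -/
lemma one_le_of_hankelCross_eq_zero {ξ : ℝ} {x y : Fin 4 → ℤ} (hx : hankelCross x = 0)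
    (hx0 : x ≠ 0) (hx1 : zL ξ x < 1) (hX : znorm y ≤ znorm x) (hL : zL ξ x ≤ zL ξ y)
    (hyx : ∃ k l, plucker y x k l ≠ 0) :
    1 ≤ (4 * powBound ξ) ^ 3 * (znorm x * zL ξ y ^ 3) := by
  have c0 := congrFun hx 0
  have c1 := congrFun hx 1
  have c2 := congrFun hx 2
  simp only [hankelCross, Matrix.cons_val, Pi.zero_apply] at c0 c1 c2
  have hx00 := coord_zero_ne_zero hx0 hx1
  have hK := one_le_powBound ξ
  obtain ⟨g, p, q, hg, hcop, hp, hq⟩ : ∃ g p q : ℤ, g ≠ 0 ∧ IsCoprime q p ∧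
      x 1 = p * g ∧ x 0 = q * g := by
    have hg : Int.gcd (x 0) (x 1) ≠ 0 := by
      simp [Int.gcd_eq_zero_iff, hx00]
    obtain ⟨q, p, h1, h2, h3⟩ := Int.exists_gcd_one (Nat.pos_of_ne_zero hg)
    exact ⟨_, p, q, by exact_mod_cast hg, Int.isCoprime_iff_gcd_eq_one.mpr h1, h3, h2⟩
  have hq0 : q ≠ 0 := by
    rintro rfl
    exact hx00 (by simpa using hq)
  have hdvd : q ^ 2 ∣ g := by
    have h1 : q ^ 2 * x 3 = p ^ 3 * g := by
      have h2 : x 0 ^ 2 * x 3 = x 1 ^ 3 := by linear_combination x 1 * c2 - x 0 * c1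
      rw [hp, hq] at h2
      refine mul_left_cancel₀ (pow_ne_zero 2 hg) ?_
      linear_combination h2
    exact (IsCoprime.pow hcop).dvd_of_dvd_mul_left (Dvd.intro _ h1)
  have hq3 : |(q : ℝ)| ^ 3 ≤ znorm x := by
    refine le_trans ?_ (abs_coord_le_znorm x 0)
    have h1 : |q ^ 2| ≤ |g| := Int.le_of_dvd (abs_pos.mpr hg) ((abs_dvd_abs _ _).mpr hdvd)
    have h2 : |q| ^ 3 ≤ |x 0| := by
      rw [hq, abs_mul]
      rw [abs_pow] at h1
      nlinarith [abs_nonneg q]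
    exact_mod_cast h2
  have hpq : |(p - q * ξ : ℝ)| * |(x 0 : ℝ)| ≤ |(q : ℝ)| * zL ξ x := by
    have h1 := abs_sub_coord_le_zL ξ x 1
    rw [← abs_mul]
    have e : ((p - q * ξ) * x 0 : ℝ) = -q * ((x 0 : ℝ) * ξ ^ ((1 : Fin 4) : ℕ) - x 1) := by
      rw [hp, hq]
      push_cast
      simp
      ring
    rw [e, abs_mul, abs_neg]
    gcongr
  obtain ⟨k, hk⟩ : ∃ k : Fin 3, p * y k.castSucc - q * y k.succ ≠ 0 := by
    by_contra! h
    have d0 : p * y 0 - q * y 1 = 0 := h 0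
    have d1 : p * y 1 - q * y 2 = 0 := h 1
    have d2 : p * y 2 - q * y 3 = 0 := h 2
    have f1 : x 0 * y 1 = y 0 * x 1 := by rw [hp, hq]; linear_combination (-g) * d0
    have f2' : x 0 * y 2 = y 1 * x 1 := by rw [hp, hq]; linear_combination (-g) * d1
    have f3' : x 0 * y 3 = y 2 * x 1 := by rw [hp, hq]; linear_combination (-g) * d2
    have f2 : x 0 * y 2 = y 0 * x 2 := by
      refine mul_left_cancel₀ hx00 ?_
      linear_combination x 0 * f2' + x 1 * f1 - y 0 * c2
    have f3 : x 0 * y 3 = y 0 * x 3 := by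
      refine mul_left_cancel₀ hx00 ?_
      linear_combination x 0 * f3' + x 1 * f2 + y 0 * c1
    have f : ∀ l, x 0 * y l = y 0 * x l := by
      intro l
      fin_cases l
      · exact mul_comm _ _
      · exact f1
      · exact f2
      · exact f3
    obtain ⟨k, l, hkl⟩ := hyx
    apply hkl
    refine mul_left_cancel₀ hx00 ?_
    simp only [plucker]
    linear_combination x l * f k - x k * f l
  have hD : (1 : ℝ) ≤ |(p * y k.castSucc - q * y k.succ : ℝ)| := by
    exact_mod_cast Int.one_le_abs hk
  have e : (p * y k.castSucc - q * y k.succ : ℝ) =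
      (p - q * ξ) * y k.castSucc + q * (ξ * y k.castSucc - y k.succ) := by ring
  rw [e] at hD
  have hD2 := hD.trans (abs_add_le _ _)
  rw [abs_mul, abs_mul] at hD2
  have h3 := ((abs_coord_le_znorm y k.castSucc).trans hX).trans (znorm_le_two_powBound_mul hx0 hx1)
  have h4 := abs_shift_le ξ y k
  have h5 : |(p - q * ξ : ℝ)| * |(y k.castSucc : ℝ)| ≤ 2 * powBound ξ * (|(q : ℝ)| * zL ξ y) :=
    calc _ ≤ |(p - q * ξ : ℝ)| * (2 * powBound ξ * |(x 0 : ℝ)|) := by gcongr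
      _ = 2 * powBound ξ * (|(p - q * ξ : ℝ)| * |(x 0 : ℝ)|) := by ring
      _ ≤ 2 * powBound ξ * (|(q : ℝ)| * zL ξ x) := by gcongr
      _ ≤ _ := by gcongr
  have h6 : |(q : ℝ)| * |(ξ * y k.castSucc - y k.succ : ℝ)| ≤
      |(q : ℝ)| * (2 * powBound ξ * zL ξ y) := by gcongr
  have h7 : 1 ≤ 4 * powBound ξ * (|(q : ℝ)| * zL ξ y) := by linarith
  calc (1 : ℝ) ≤ (4 * powBound ξ * (|(q : ℝ)| * zL ξ y)) ^ 3 := one_le_pow₀ h7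
    _ = (4 * powBound ξ) ^ 3 * (|(q : ℝ)| ^ 3 * zL ξ y ^ 3) := by ring
    _ ≤ _ := by
      have := zL_nonneg ξ y
      gcongr

/-! ### Subspaces -/

lemma linearIndependent_rvec {u v : Fin 4 → ℤ} (h : ∃ k l, plucker u v k l ≠ 0) :
    LinearIndependent ℝ ![rvec u, rvec v] := by
  obtain ⟨k, l, hkl⟩ := h
  have hkl' : (plucker u v k l : ℝ) ≠ 0 := by exact_mod_cast hkl
  simp only [plucker] at hkl'
  push_cast at hkl'
  rw [LinearIndependent.pair_iff]
  intro s t hst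
  have ek := congrFun hst k
  have el := congrFun hst l
  simp only [rvec, Pi.add_apply, Pi.smul_apply, smul_eq_mul, Pi.zero_apply] at ek el
  constructor
  · refine (mul_eq_zero.mp ?_).resolve_left hkl'
    linear_combination (v l : ℝ) * ek - (v k : ℝ) * el
  · refine (mul_eq_zero.mp ?_).resolve_left hkl'
    linear_combination (u k : ℝ) * el - (u l : ℝ) * ek

/-- The space of real solutions of the recurrence relation with coefficients `a`. -/
def recursSpace (a : Fin 3 → ℤ) : Submodule ℝ (Fin 4 → ℝ) where
  carrier := {w | a 0 * w 0 + a 1 * w 1 + a 2 * w 2 = 0 ∧ a 0 * w 1 + a 1 * w 2 + a 2 * w 3 = 0}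
  add_mem' := by
    rintro v w ⟨h1, h2⟩ ⟨h3, h4⟩
    simp only [Set.mem_ofPred_eq, Pi.add_apply]
    exact ⟨by linear_combination h1 + h3, by linear_combination h2 + h4⟩
  zero_mem' := by simp
  smul_mem' := by
    rintro t v ⟨h1, h2⟩
    simp only [Set.mem_ofPred_eq, Pi.smul_apply, smul_eq_mul]
    exact ⟨by linear_combination t * h1, by linear_combination t * h2⟩

lemma rvec_mem_recursSpace {a : Fin 3 → ℤ} {x : Fin 4 → ℤ} :
    rvec x ∈ recursSpace a ↔ Recurs a x := by
  change ((a 0 * x 0 + a 1 * x 1 + a 2 * x 2 : ℝ) = 0 ∧ (a 0 * x 1 + a 1 * x 2 + a 2 * x 3 : ℝ) = 0)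
    ↔ _
  unfold Recurs
  norm_cast

lemma finrank_recursSpace_le {a : Fin 3 → ℤ} (ha : a ≠ 0) :
    Module.finrank ℝ (recursSpace a) ≤ 2 := by
  have key : ∀ k l : Fin 4, (∀ w ∈ recursSpace a, w k = 0 → w l = 0 → w = 0) →
      Module.finrank ℝ (recursSpace a) ≤ 2 := by
    intro k l h
    let f : recursSpace a →ₗ[ℝ] (Fin 2 → ℝ) :=
      (LinearMap.pi ![LinearMap.proj k, LinearMap.proj l]).comp (recursSpace a).subtype
    have hf : Function.Injective f := by
      rw [← LinearMap.ker_eq_bot, LinearMap.ker_eq_bot']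
      rintro ⟨w, hw⟩ h0
      have hk : w k = 0 := congrFun h0 0
      have hl : w l = 0 := congrFun h0 1
      exact Subtype.ext (h w hw hk hl)
    simpa using LinearMap.finrank_le_finrank_of_injective hf
  by_cases h2 : a 2 = 0
  · by_cases h1 : a 1 = 0
    · have h0 : (a 0 : ℝ) ≠ 0 := by
        norm_cast
        intro h0
        apply ha
        ext k
        fin_cases k <;> simp [h0, h1, h2]
      refine key 2 3 ?_
      rintro w ⟨e1, e2⟩ hk hl
      have w0 : w 0 = 0 := by simpa [h1, h2, h0] using e1
      have w1 : w 1 = 0 := by simpa [h1, h2, h0] using e2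
      ext k
      fin_cases k <;> simp [w0, w1, hk, hl]
    · have h1' : (a 1 : ℝ) ≠ 0 := by exact_mod_cast h1
      refine key 0 3 ?_
      rintro w ⟨e1, e2⟩ hk hl
      have w1 : w 1 = 0 := by simpa [h1, h2, hk] using e1
      have w2 : w 2 = 0 := by simpa [h1, h2, w1] using e2
      ext k
      fin_cases k <;> simp [w1, w2, hk, hl]
  · have h2' : (a 2 : ℝ) ≠ 0 := by exact_mod_cast h2
    refine key 0 1 ?_
    rintro w ⟨e1, e2⟩ hk hl
    have w2 : w 2 = 0 := by simpa [h2, hk, hl] using e1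
    have w3 : w 3 = 0 := by simpa [h2, w2, hl] using e2
    ext k
    fin_cases k <;> simp [w2, w3, hk, hl]

lemma finrank_span_rvec {u v : Fin 4 → ℤ} (huv : ∃ k l, plucker u v k l ≠ 0) :
    Module.finrank ℝ (Submodule.span ℝ {rvec u, rvec v}) = 2 := by
  have hr : Set.range ![rvec u, rvec v] = {rvec u, rvec v} :=
    Matrix.range_cons_cons_empty _ _ _
  rw [← hr]
  simpa using finrank_span_eq_card (linearIndependent_rvec huv)

lemma span_eq_recursSpace {a : Fin 3 → ℤ} {u v : Fin 4 → ℤ} (ha : a ≠ 0) (hu : Recurs a u)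
    (hv : Recurs a v) (huv : ∃ k l, plucker u v k l ≠ 0) :
    Submodule.span ℝ {rvec u, rvec v} = recursSpace a := by
  refine Submodule.eq_of_le_of_finrank_le ?_
    ((finrank_recursSpace_le ha).trans_eq (finrank_span_rvec huv).symm)
  rw [Submodule.span_le]
  rintro w (rfl | rfl)
  · exact rvec_mem_recursSpace.mpr hu
  · exact rvec_mem_recursSpace.mpr hv

/-! ### Determinants -/

lemma abs_det_three_le {a₁ a₂ a₃ b₁ b₂ b₃ c₁ c₂ c₃ A B C : ℝ}
    (ha₁ : |a₁| ≤ A) (ha₂ : |a₂| ≤ A) (ha₃ : |a₃| ≤ A)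
    (hb₁ : |b₁| ≤ B) (hb₂ : |b₂| ≤ B) (hb₃ : |b₃| ≤ B)
    (hc₁ : |c₁| ≤ C) (hc₂ : |c₂| ≤ C) (hc₃ : |c₃| ≤ C) :
    |a₁ * (b₂ * c₃ - b₃ * c₂) - a₂ * (b₁ * c₃ - b₃ * c₁) + a₃ * (b₁ * c₂ - b₂ * c₁)| ≤
      6 * (A * (B * C)) := by
  have hB : 0 ≤ B := (abs_nonneg _).trans hb₁
  have minor : ∀ {p q r s : ℝ}, |p| ≤ B → |q| ≤ C → |r| ≤ B → |s| ≤ C →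
      |p * q - r * s| ≤ 2 * (B * C) := by
    intro p q r s hp hq hr hs
    refine (abs_sub _ _).trans ?_
    rw [abs_mul, abs_mul, two_mul]
    gcongr
  have h := abs_combination_le ha₁ ha₂ ha₃ (minor hb₂ hc₃ hb₃ hc₂) (minor hb₁ hc₃ hb₃ hc₁)
    (minor hb₁ hc₂ hb₂ hc₁)
  linarith

lemma abs_det_le {ξ : ℝ} {z y x w : Fin 4 → ℤ}
    (hX₁ : znorm z ≤ znorm w) (hX₂ : znorm y ≤ znorm w) (hX₃ : znorm x ≤ znorm w)
    (hL₁ : zL ξ w ≤ zL ξ z) (hL₂ : zL ξ w ≤ zL ξ y) (hL₃ : zL ξ w ≤ zL ξ x) :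
    |((Matrix.of ![z, y, x, w]).det : ℝ)| ≤
      24 * (znorm w * (zL ξ z * (zL ξ y * zL ξ x))) := by
  have hLz := zL_nonneg ξ z
  have hLy := zL_nonneg ξ y
  have hLx := zL_nonneg ξ x
  have hW : 0 ≤ znorm w := (abs_nonneg _).trans (abs_coord_le_znorm w 0)
  let d : (Fin 4 → ℤ) → Fin 4 → ℝ := fun v k => (v 0 : ℝ) * ξ ^ (k : ℕ) - v k
  let D : (Fin 4 → ℤ) → (Fin 4 → ℤ) → (Fin 4 → ℤ) → ℝ := fun a b c =>
    d a 1 * (d b 2 * d c 3 - d b 3 * d c 2) - d a 2 * (d b 1 * d c 3 - d b 3 * d c 1)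
      + d a 3 * (d b 1 * d c 2 - d b 2 * d c 1)
  have hd : ∀ v k, |d v k| ≤ zL ξ v := fun v k => abs_sub_coord_le_zL ξ v k
  have hD : ∀ a b c, |D a b c| ≤ 6 * (zL ξ a * (zL ξ b * zL ξ c)) := fun a b c =>
    abs_det_three_le (hd _ _) (hd _ _) (hd _ _) (hd _ _) (hd _ _) (hd _ _) (hd _ _) (hd _ _)
      (hd _ _)
  have e : ((Matrix.of ![z, y, x, w]).det : ℝ) =
      w 0 * D z y x - x 0 * D z y w + y 0 * D z x w - z 0 * D y x w := by
    have h2 : ((2 : Fin 4) : ℕ) = 2 := rfl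
    have h3 : ((3 : Fin 4) : ℕ) = 3 := rfl
    simp only [D, d, h2, h3, Fin.val_one]
    rw [Matrix.det_succ_column_zero]
    simp [Fin.sum_univ_four, Matrix.det_fin_three, Fin.succAbove]
    ring
  have t1 : |(w 0 : ℝ) * D z y x| ≤ 6 * (znorm w * (zL ξ z * (zL ξ y * zL ξ x))) := by
    rw [abs_mul]
    calc _ ≤ znorm w * (6 * (zL ξ z * (zL ξ y * zL ξ x))) := by
          gcongr
          · exact abs_coord_le_znorm w 0
          · exact hD z y x
      _ = _ := by ring
  have t2 : |(x 0 : ℝ) * D z y w| ≤ 6 * (znorm w * (zL ξ z * (zL ξ y * zL ξ x))) := by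
    rw [abs_mul]
    calc _ ≤ znorm w * (6 * (zL ξ z * (zL ξ y * zL ξ x))) := by
          gcongr
          · exact (abs_coord_le_znorm x 0).trans hX₃
          · exact (hD z y w).trans (by gcongr)
      _ = _ := by ring
  have t3 : |(y 0 : ℝ) * D z x w| ≤ 6 * (znorm w * (zL ξ z * (zL ξ y * zL ξ x))) := by
    rw [abs_mul]
    calc _ ≤ znorm w * (6 * (zL ξ z * (zL ξ x * zL ξ y))) := by
          gcongr
          · exact (abs_coord_le_znorm y 0).trans hX₂
          · exact (hD z x w).trans (by gcongr)
      _ = _ := by ring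
  have t4 : |(z 0 : ℝ) * D y x w| ≤ 6 * (znorm w * (zL ξ z * (zL ξ y * zL ξ x))) := by
    rw [abs_mul]
    calc _ ≤ znorm w * (6 * (zL ξ y * (zL ξ x * zL ξ z))) := by
          gcongr
          · exact (abs_coord_le_znorm z 0).trans hX₁
          · exact (hD y x w).trans (by gcongr)
      _ = _ := by ring
  rw [e]
  rw [abs_le] at *
  constructor <;> linarith [t1.1, t1.2, t2.1, t2.2, t3.1, t3.2, t4.1, t4.2]

/-- Two distinct hyperplanes spanned by a plane and an extra integer point each give rise to four
integer points with non-zero determinant. -/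
lemma det_ne_zero_of_sup_ne {z y x w : Fin 4 → ℤ} (hyx : ∃ k l, plucker y x k l ≠ 0)
    (hz : rvec z ∉ Submodule.span ℝ {rvec y, rvec x})
    (hw : rvec w ∉ Submodule.span ℝ {rvec y, rvec x})
    (hne : Submodule.span ℝ {rvec y, rvec x} ⊔ Submodule.span ℝ {rvec z} ≠
      Submodule.span ℝ {rvec y, rvec x} ⊔ Submodule.span ℝ {rvec w}) :
    (Matrix.of ![z, y, x, w]).det ≠ 0 := by
  intro hdet
  have hdet' : ((Matrix.of ![z, y, x, w]).map (Int.castRingHom ℝ)).det = 0 := by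
    rw [← RingHom.mapMatrix_apply, ← RingHom.map_det, hdet, map_zero]
  obtain ⟨s, hs0, hs⟩ := Matrix.exists_vecMul_eq_zero_iff.mpr hdet'
  set W := Submodule.span ℝ {rvec y, rvec x} with hW
  have hrel : s 0 • rvec z + s 1 • rvec y + s 2 • rvec x + s 3 • rvec w = 0 := by
    ext k
    have := congrFun hs k
    simpa [Matrix.vecMul, dotProduct, Fin.sum_univ_four, rvec] using this
  have hyW : rvec y ∈ W := Submodule.subset_span (by simp)
  have hxW : rvec x ∈ W := Submodule.subset_span (by simp)
  have hm : s 1 • rvec y + s 2 • rvec x ∈ W :=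
    W.add_mem (W.smul_mem _ hyW) (W.smul_mem _ hxW)
  have sup_le : ∀ {p q : Fin 4 → ℝ} {α β : ℝ}, α ≠ 0 →
      α • p + (s 1 • rvec y + s 2 • rvec x) + β • q = 0 →
      W ⊔ Submodule.span ℝ {p} ≤ W ⊔ Submodule.span ℝ {q} := by
    intro p q α β hα h
    refine _root_.sup_le le_sup_left ?_
    rw [Submodule.span_singleton_le_iff_mem]
    have h1 : α • p ∈ W ⊔ Submodule.span ℝ {q} := by
      have h2 : α • p = -(s 1 • rvec y + s 2 • rvec x) + (-β) • q := by
        rw [← sub_eq_zero, ← h]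
        module
      rw [h2]
      exact Submodule.add_mem_sup (W.neg_mem hm)
        (Submodule.smul_mem _ _ (Submodule.mem_span_singleton_self q))
    exact (Submodule.smul_mem_iff _ hα).mp h1
  by_cases h0 : s 0 = 0
  · by_cases h3 : s 3 = 0
    · rw [h0, h3, zero_smul, zero_smul, zero_add, add_zero] at hrel
      obtain ⟨h1, h2⟩ := LinearIndependent.pair_iff.mp (linearIndependent_rvec hyx) _ _ hrel
      apply hs0
      ext k
      fin_cases k <;> simp [h0, h1, h2, h3]
    · apply hw
      refine (Submodule.smul_mem_iff _ h3).mp ?_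
      have : s 3 • rvec w = -(s 1 • rvec y + s 2 • rvec x) := by
        rw [h0] at hrel
        rw [← sub_eq_zero, ← hrel]
        module
      rw [this]
      exact W.neg_mem hm
  · by_cases h3 : s 3 = 0
    · apply hz
      refine (Submodule.smul_mem_iff _ h0).mp ?_
      have : s 0 • rvec z = -(s 1 • rvec y + s 2 • rvec x) := by
        rw [h3] at hrel
        rw [← sub_eq_zero, ← hrel]
        module
      rw [this]
      exact W.neg_mem hm
    · refine hne (le_antisymm (sup_le h0 (β := s 3) ?_) (sup_le h3 (β := s 0) ?_))
      · rw [← hrel]; module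
      · rw [← hrel]; module

/-! ### Finiteness -/

lemma eq_zero_of_linearIndependent {ξ : ℝ} (hξ : LinearIndependent ℚ ![(1 : ℝ), ξ, ξ ^ 2, ξ ^ 3])
    {b : Fin 4 → ℤ} (hb : (b 0 + b 1 * ξ + b 2 * ξ ^ 2 + b 3 * ξ ^ 3 : ℝ) = 0) : b = 0 := by
  rw [Fintype.linearIndependent_iff] at hξ
  have h := hξ (fun k => (b k : ℚ)) (by
    simpa [Fin.sum_univ_four, Rat.smul_def] using hb)
  ext k
  exact_mod_cast h k

lemma ne_zero_of_linearIndependent {ξ : ℝ}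
    (hξ : LinearIndependent ℚ ![(1 : ℝ), ξ, ξ ^ 2, ξ ^ 3]) : ξ ≠ 0 := by
  simpa using hξ.ne_zero 1

lemma zL_pos {ξ : ℝ} (hξ : LinearIndependent ℚ ![(1 : ℝ), ξ, ξ ^ 2, ξ ^ 3])
    {x : Fin 4 → ℤ} (hx : x ≠ 0) : 0 < zL ξ x := by
  refine (zL_nonneg ξ x).lt_of_ne' fun h => hx ?_
  have hk : ∀ k : Fin 4, (x 0 : ℝ) * ξ ^ (k : ℕ) - x k = 0 := fun k =>
    abs_eq_zero.mp (le_antisymm ((abs_sub_coord_le_zL ξ x k).trans_eq h) (abs_nonneg _))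
  have h1 := hk 1
  simp only [Fin.val_one, pow_one] at h1
  have h2 := eq_zero_of_linearIndependent hξ (b := ![-x 1, x 0, 0, 0])
    (by simp; linear_combination h1)
  have h0 : x 0 = 0 := by simpa using congrFun h2 1
  ext k
  have := hk k
  simpa [h0] using this

lemma exists_pos_le_of_abs_le (f : (Fin 4 → ℤ) → ℝ) (hf : ∀ y, y ≠ 0 → 0 < f y) (B : ℝ) :
    ∃ μ : ℝ, 0 < μ ∧ ∀ y : Fin 4 → ℤ, y ≠ 0 → (∀ k, |(y k : ℝ)| ≤ B) → μ ≤ f y := by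
  let S : Set (Fin 4 → ℤ) := {y | y ≠ 0 ∧ ∀ k, |(y k : ℝ)| ≤ B}
  have hS : S.Finite := by
    refine (Set.finite_Icc (fun _ => -⌈B⌉ : Fin 4 → ℤ) (fun _ => ⌈B⌉)).subset ?_
    rintro y ⟨-, hy⟩
    have : ∀ k, |y k| ≤ ⌈B⌉ := fun k => by
      have := (hy k).trans (Int.le_ceil B)
      exact_mod_cast this
    exact ⟨fun k => (abs_le.mp (this k)).1, fun k => (abs_le.mp (this k)).2⟩
  rcases S.eq_empty_or_nonempty with h | h
  · refine ⟨1, one_pos, fun y hy hB => ?_⟩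
    have : y ∈ S := ⟨hy, hB⟩
    simp [h] at this
  · obtain ⟨y, hy, hmin⟩ := Set.exists_min_image S f hS h
    exact ⟨f y, hf y hy.1, fun z hz hB => hmin z ⟨hz, hB⟩⟩

/-! ### Sequences of minimal points -/

namespace IsMinimalSeq

variable {ξ : ℝ} {x : ℕ → Fin 4 → ℤ}

lemma znorm_mono (h : IsMinimalSeq ξ x) {i k : ℕ} (hi : 1 ≤ i) (hik : i ≤ k) :
    znorm (x i) ≤ znorm (x k) := by
  induction k, hik using Nat.le_induction with
  | base => exact le_rfl
  | succ k hk ih => exact ih.trans (h.2.1 k (hi.trans hk)).le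

lemma zL_anti (h : IsMinimalSeq ξ x) {i k : ℕ} (hi : 1 ≤ i) (hik : i ≤ k) :
    zL ξ (x k) ≤ zL ξ (x i) := by
  induction k, hik using Nat.le_induction with
  | base => exact le_rfl
  | succ k hk ih => exact (h.2.2.1 k (hi.trans hk)).le.trans ih

lemma one_le_znorm (h : IsMinimalSeq ξ x) {i : ℕ} (hi : 1 ≤ i) : 1 ≤ znorm (x i) :=
  _root_.one_le_znorm (h.1 i hi)

lemma log_nonneg (h : IsMinimalSeq ξ x) {i : ℕ} (hi : 1 ≤ i) : 0 ≤ Real.log (znorm (x i)) :=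
  Real.log_nonneg (h.one_le_znorm hi)

lemma log_mono (h : IsMinimalSeq ξ x) {i k : ℕ} (hi : 1 ≤ i) (hik : i ≤ k) :
    Real.log (znorm (x i)) ≤ Real.log (znorm (x k)) :=
  Real.log_le_log (zero_lt_one.trans_le (h.one_le_znorm hi)) (h.znorm_mono hi hik)

lemma zL_pos (h : IsMinimalSeq ξ x) {i : ℕ} (hi : 1 ≤ i) : 0 < zL ξ (x i) :=
  (zL_nonneg ξ _).trans_lt (h.2.2.1 i hi)

lemma zL_le_one (h : IsMinimalSeq ξ x) {i : ℕ} (hi : 1 ≤ i) : zL ξ (x i) ≤ 1 := by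
  refine (h.zL_anti le_rfl hi).trans ?_
  by_contra! h1
  have h2 : zL ξ ![0, 0, 0, 1] = 1 := by simp [zL]
  have h3 : znorm ![0, 0, 0, 1] = 1 := by simp [znorm]
  have h4 := h.2.2.2 1 le_rfl ![0, 0, 0, 1] (fun h0 => by simpa using congrFun h0 3)
    (h2.trans_lt h1)
  have h5 := h.2.1 1 le_rfl
  have h6 := h.one_le_znorm le_rfl
  linarith

lemma zL_lt_one (h : IsMinimalSeq ξ x) {i : ℕ} (hi : 2 ≤ i) : zL ξ (x i) < 1 := by
  obtain ⟨k, rfl⟩ : ∃ k, i = k + 1 := ⟨i - 1, by omega⟩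
  exact (h.2.2.1 k (by omega)).trans_le (h.zL_le_one (by omega))

lemma plucker_ne_zero (h : IsMinimalSeq ξ x) {i : ℕ} (hi : 1 ≤ i) :
    ∃ k l, plucker (x i) (x (i + 1)) k l ≠ 0 :=
  exists_plucker_ne_zero (h.1 i hi) (h.2.1 i hi) (h.2.2.1 i hi)

lemma plucker_le (h : IsMinimalSeq ξ x) {i : ℕ} (hi : 1 ≤ i) (k l : Fin 4) :
    |(plucker (x i) (x (i + 1)) k l : ℝ)| ≤
      4 * powBound ξ * (znorm (x (i + 1)) * zL ξ (x i)) :=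
  abs_plucker_le (h.2.1 i hi).le (h.2.2.1 i hi).le k l

end IsMinimalSeq

lemma exists_zL_le_mul_rpow {ξ c lam : ℝ} (hc : 0 < c) (hlam : 0 < lam)
    (happrox : ApproxHyp ξ c lam) :
    ∃ C : ℝ, 0 < C ∧ ∀ x, IsMinimalSeq ξ x → ∀ i, 1 ≤ i →
      zL ξ (x i) ≤ C * znorm (x (i + 1)) ^ (-lam) := by
  obtain ⟨X₀, hX₀⟩ := happrox
  have hK := one_le_powBound ξ
  set K := powBound ξ with hKdef
  set T := max (2 * K * max X₀ 1) (2 * c + 1) with hT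
  have hT1 : 2 * K * max X₀ 1 ≤ T := le_max_left _ _
  have hT2 : 2 * c + 1 ≤ T := le_max_right _ _
  have hTpos : 0 < T := by linarith
  refine ⟨c * (2 * K) ^ lam + T ^ lam, by positivity, fun x h i hi => ?_⟩
  have hX1 := h.one_le_znorm (i := i + 1) (by omega)
  set X := znorm (x (i + 1)) with hX
  have hXpos : 0 < X := by linarith
  have hXr : 0 < X ^ (-lam) := Real.rpow_pos_of_pos hXpos _
  rcases le_or_gt T X with hTX | hTX
  · have hQ : max X₀ 1 ≤ X / (2 * K) := by
      rw [le_div_iff₀ (by positivity)]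
      linarith
    obtain ⟨y, hy0, hyX, hyL⟩ := hX₀ (X / (2 * K)) ((le_max_left _ _).trans hQ)
    have hQ1 : 1 ≤ X / (2 * K) := (le_max_right _ _).trans hQ
    have hLy : zL ξ y ≤ c * (X / (2 * K)) ^ (-lam) := by
      refine zL_le fun k => ?_
      rcases Nat.eq_zero_or_pos (k : ℕ) with hk | hk
      · have : k = 0 := Fin.ext hk
        subst this
        simp
        positivity
      · exact hyL k hk
    have hr1 : (X / (2 * K)) ^ (-lam) ≤ 1 :=
      Real.rpow_le_one_of_one_le_of_nonpos hQ1 (by linarith)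
    have hnorm : znorm y < X := by
      have h1 := znorm_le_powBound_mul ξ y
      have h2 : K * |(y 0 : ℝ)| ≤ K * (X / (2 * K)) := by gcongr
      have h3 : K * (X / (2 * K)) = X / 2 := by field_simp
      nlinarith
    have hle : zL ξ (x i) ≤ zL ξ y := by
      by_contra! hlt
      have := h.2.2.2 i hi y hy0 hlt
      linarith
    have e : (X / (2 * K)) ^ (-lam) = (2 * K) ^ lam * X ^ (-lam) := by
      rw [Real.div_rpow hXpos.le (by positivity), Real.rpow_neg (by positivity : 0 ≤ 2 * K),
        div_inv_eq_mul, mul_comm]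
    calc zL ξ (x i) ≤ c * ((2 * K) ^ lam * X ^ (-lam)) := by rw [← e]; exact hle.trans hLy
      _ ≤ (c * (2 * K) ^ lam + T ^ lam) * X ^ (-lam) := by
        have : 0 ≤ T ^ lam * X ^ (-lam) := by positivity
        linarith
  · have h1 := h.zL_le_one hi
    have h2 : 1 ≤ T ^ lam * X ^ (-lam) := by
      rw [Real.rpow_neg hXpos.le, ← div_eq_mul_inv, one_le_div (by positivity)]
      exact Real.rpow_le_rpow hXpos.le hTX.le hlam.le
    have : 0 ≤ c * (2 * K) ^ lam * X ^ (-lam) := by positivity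
    linarith

lemma exists_log_zL_le {ξ c lam : ℝ} (hc : 0 < c) (hlam : 0 < lam)
    (happrox : ApproxHyp ξ c lam) :
    ∃ C : ℝ, ∀ x, IsMinimalSeq ξ x → ∀ i, 1 ≤ i →
      Real.log (zL ξ (x i)) ≤ C - lam * Real.log (znorm (x (i + 1))) := by
  obtain ⟨C, hC, hle⟩ := exists_zL_le_mul_rpow hc hlam happrox
  refine ⟨Real.log C, fun x h i hi => ?_⟩
  have hX : 0 < znorm (x (i + 1)) := zero_lt_one.trans_le (h.one_le_znorm (by omega))
  have h1 := Real.log_le_log (h.zL_pos hi) (hle x h i hi)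
  rw [Real.log_mul hC.ne' (Real.rpow_pos_of_pos hX _).ne', Real.log_rpow hX] at h1
  linarith

lemma exists_log_znorm_succ_le {ξ c lam : ℝ}
    (hξ : LinearIndependent ℚ ![(1 : ℝ), ξ, ξ ^ 2, ξ ^ 3]) (hc : 0 < c) (hlam : 0 < lam)
    (happrox : ApproxHyp ξ c lam) (B : ℝ) :
    ∃ B' : ℝ, ∀ x, IsMinimalSeq ξ x → ∀ i, 1 ≤ i → Real.log (znorm (x i)) ≤ B →
      Real.log (znorm (x (i + 1))) ≤ B' := by
  obtain ⟨C, hC⟩ := exists_log_zL_le hc hlam happrox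
  obtain ⟨μ, hμ, hle⟩ := exists_pos_le_of_abs_le (zL ξ) (fun y hy => zL_pos hξ hy) (Real.exp B)
  refine ⟨(C - Real.log μ) / lam, fun x h i hi hB => ?_⟩
  have hX : 0 < znorm (x i) := zero_lt_one.trans_le (h.one_le_znorm hi)
  have h1 := hle (x i) (h.1 i hi) fun k =>
    (abs_coord_le_znorm _ k).trans ((Real.log_le_iff_le_exp hX).mp hB)
  have h2 := Real.log_le_log hμ h1
  have h3 := hC x h i hi
  rw [le_div_iff₀ hlam]
  linarith

/-- Bounded geometric progressions. -/
lemma exists_log_znorm_le_of_hankelCross_eq_zero {ξ c lam : ℝ} (hc : 0 < c) (hlam : 1 / 3 < lam)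
    (happrox : ApproxHyp ξ c lam) :
    ∃ B : ℝ, ∀ x, IsMinimalSeq ξ x → ∀ i, 1 ≤ i → hankelCross (x (i + 1)) = 0 →
      Real.log (znorm (x (i + 1))) ≤ B := by
  obtain ⟨C, hC⟩ := exists_log_zL_le hc (by linarith) happrox
  have hK := one_le_powBound ξ
  refine ⟨(Real.log ((4 * powBound ξ) ^ 3) + 3 * C) / (3 * lam - 1), fun x h i hi h0 => ?_⟩
  have hX : 0 < znorm (x (i + 1)) := zero_lt_one.trans_le (h.one_le_znorm (by omega))
  have hL := h.zL_pos hi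
  have h1 := Real.log_nonneg (one_le_of_hankelCross_eq_zero h0 (h.1 _ (by omega))
    (h.zL_lt_one (by omega)) (h.2.1 i hi).le (h.2.2.1 i hi).le (h.plucker_ne_zero hi))
  rw [Real.log_mul (by positivity) (by positivity), Real.log_mul hX.ne' (by positivity),
    Real.log_pow (n := 3) (x := zL ξ (x i))] at h1
  have h2 := hC x h i hi
  push_cast at h1
  rw [le_div_iff₀ (by linarith)]
  linarith

lemma exists_recurs_or_log_le {ξ : ℝ} (hξ : ξ ≠ 0) :
    ∃ C : ℝ, ∀ x, IsMinimalSeq ξ x → ∀ i j, 1 ≤ i → 1 ≤ j →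
      rvec (x j) ∈ Submodule.span ℝ {rvec (x i), rvec (x (i + 1))} →
      (Recurs (hankelCross (x j)) (x i) ∧ Recurs (hankelCross (x j)) (x (i + 1))) ∨
      0 ≤ C + Real.log (znorm (x (i + 1))) + Real.log (zL ξ (x i)) + Real.log (zL ξ (x j)) := by
  have hK := one_le_powBound ξ
  have hm : 0 < min 1 |ξ| := lt_min one_pos (abs_pos.mpr hξ)
  refine ⟨Real.log (24 * powBound ξ ^ 2 / min 1 |ξ|), fun x h i j hi hj hmem => ?_⟩
  obtain ⟨α, β, hαβ⟩ := Submodule.mem_span_pair.mp hmem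
  have hx : ∀ k, ((x j) k : ℝ) = α * x i k + β * x (i + 1) k := fun k =>
    (congrFun hαβ k).symm
  refine (recurs_or_le (ξ := ξ) hx (h.plucker_le hi)).imp_right fun hle => ?_
  have hX : 0 < znorm (x (i + 1)) := zero_lt_one.trans_le (h.one_le_znorm (by omega))
  have hLi := h.zL_pos hi
  have hLj := h.zL_pos hj
  have h1 : 1 ≤ 24 * powBound ξ ^ 2 / min 1 |ξ| *
      (znorm (x (i + 1)) * (zL ξ (x i) * zL ξ (x j))) := by
    rw [div_mul_eq_mul_div, one_le_div hm]
    refine hle.trans_eq ?_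
    ring
  have h2 := Real.log_nonneg h1
  rw [Real.log_mul (by positivity) (by positivity), Real.log_mul hX.ne' (by positivity),
    Real.log_mul hLi.ne' hLj.ne'] at h2
  linarith

lemma exists_log_le_of_not_recurs (ξ : ℝ) :
    ∃ C : ℝ, ∀ x, IsMinimalSeq ξ x → ∀ i, 1 ≤ i → ∀ a : Fin 3 → ℤ, a ≠ 0 →
      Recurs a (x (i + 1)) → Recurs a (x (i + 2)) → ¬ Recurs a (x i) →
      0 ≤ C + Real.log (znorm (x (i + 2))) + Real.log (zL ξ (x (i + 1)))
        + 2 * Real.log (zL ξ (x i)) := by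
  have hK := one_le_powBound ξ
  refine ⟨Real.log ((9 * powBound ξ ^ 2) ^ 2 * (8 * powBound ξ)), fun x h i hi a ha h1 h2 h0 => ?_⟩
  have hX : 0 < znorm (x (i + 2)) := zero_lt_one.trans_le (h.one_le_znorm (by omega))
  have hLi := h.zL_pos hi
  have hLj := h.zL_pos (i := i + 1) (by omega)
  obtain ⟨b, hb, hiff, hsq⟩ := exists_recurs_sq_le ha h1 h2 (h.plucker_ne_zero (by omega))
    (h.plucker_le (by omega))
  set N := 4 * powBound ξ * (znorm (x (i + 2)) * zL ξ (x (i + 1))) with hN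
  have hle := one_le_coeff_mul (ξ := ξ) (A := √(2 * N)) (fun k => Real.abs_le_sqrt (hsq k))
    ((hiff _).mpr h1)
    (fun hr => h0 ((hiff _).mp hr)) (h.1 _ (by omega)) (h.zL_lt_one (by omega)) (h.2.1 i hi).le
    (h.2.2.1 i hi).le
  have h3 : 1 ≤ (9 * powBound ξ ^ 2) ^ 2 * (8 * powBound ξ) *
      (znorm (x (i + 2)) * (zL ξ (x (i + 1)) * zL ξ (x i) ^ 2)) := by
    refine (one_le_pow₀ hle (n := 2)).trans_eq ?_
    rw [mul_pow, mul_pow (√(2 * N)), Real.sq_sqrt (by positivity), hN]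
    ring
  have h4 := Real.log_nonneg h3
  rw [Real.log_mul (by positivity) (by positivity), Real.log_mul hX.ne' (by positivity),
    Real.log_mul hLj.ne' (by positivity), Real.log_pow (n := 2) (x := zL ξ (x i))] at h4
  push_cast at h4
  linarith

lemma exists_log_znorm_le_of_recurs {ξ : ℝ}
    (hξ : LinearIndependent ℚ ![(1 : ℝ), ξ, ξ ^ 2, ξ ^ 3]) (B : ℝ) :
    ∃ B' : ℝ, ∀ x, IsMinimalSeq ξ x → ∀ i j, 1 ≤ i → 2 ≤ j → ∀ a : Fin 3 → ℤ, a ≠ 0 →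
      Recurs a (x i) → Recurs a (x (i + 1)) → Recurs a (x j) →
      Real.log (znorm (x (i + 1))) ≤ B → Real.log (znorm (x j)) ≤ B' := by
  have hK := one_le_powBound ξ
  set A := √(2 * (4 * powBound ξ * (Real.exp B * 1))) with hA
  obtain ⟨μ, hμ, hle⟩ := exists_pos_le_of_abs_le
    (fun b => |(b 0 + b 1 * ξ + b 2 * ξ ^ 2 + b 3 * ξ ^ 3 : ℝ)|)
    (fun b hb => abs_pos.mpr fun h0 => hb (eq_zero_of_linearIndependent hξ h0)) A
  refine ⟨Real.log (2 * powBound ξ * (3 * A / μ)), fun x h i j hi hj a ha h1 h2 h3 hB => ?_⟩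
  have hX : 0 < znorm (x (i + 1)) := zero_lt_one.trans_le (h.one_le_znorm (by omega))
  have hXj : 0 < znorm (x j) := zero_lt_one.trans_le (h.one_le_znorm (by omega))
  have hLi := h.zL_le_one hi
  have hLi0 := h.zL_pos hi
  obtain ⟨b, hb, hiff, hsq⟩ := exists_recurs_sq_le ha h1 h2 (h.plucker_ne_zero hi)
    (h.plucker_le hi)
  have hbA : ∀ k, |(b k : ℝ)| ≤ A := fun k => by
    refine Real.abs_le_sqrt ((hsq k).trans ?_)
    have := (Real.log_le_iff_le_exp hX).mp hB
    gcongr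
  have hA0 : 0 ≤ A := Real.sqrt_nonneg _
  have hev := abs_eval_mul_le (ξ := ξ) hbA ((hiff _).mpr h3)
  have hμ1 : μ ≤ |(b 0 + b 1 * ξ + b 2 * ξ ^ 2 : ℝ)| := by
    have := hle ![b 0, b 1, b 2, 0] (fun h0 => hb (by
      ext k
      fin_cases k
      · simpa using congrFun h0 0
      · simpa using congrFun h0 1
      · simpa using congrFun h0 2)) (by
      intro k
      fin_cases k
      · simpa using hbA 0
      · simpa using hbA 1
      · simpa using hbA 2
      · simpa using hA0)
    simpa using this
  have hx0 : |(x j 0 : ℝ)| ≤ 3 * A / μ := by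
    rw [le_div_iff₀ hμ]
    have h4 : μ * |(x j 0 : ℝ)| ≤ |(b 0 + b 1 * ξ + b 2 * ξ ^ 2 : ℝ)| * |(x j 0 : ℝ)| := by gcongr
    have h5 : A * zL ξ (x j) ≤ A * 1 := by
      have := h.zL_le_one (i := j) (by omega)
      gcongr
    linarith
  refine Real.log_le_log hXj ?_
  refine (znorm_le_two_powBound_mul (h.1 j (by omega)) (h.zL_lt_one hj)).trans ?_
  gcongr

/-! ### The planes spanned by consecutive minimal points -/

lemma rvec_mem_Wspace (x : ℕ → Fin 4 → ℤ) (i : ℕ) : rvec (x i) ∈ Wspace x i :=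
  Submodule.subset_span (by simp)

lemma rvec_mem_Wspace_succ (x : ℕ → Fin 4 → ℤ) (i : ℕ) : rvec (x i) ∈ Wspace x (i + 1) :=
  Submodule.subset_span (by simp)

lemma Wspace_succ_le_iff {x : ℕ → Fin 4 → ℤ} {i : ℕ} {V : Submodule ℝ (Fin 4 → ℝ)} :
    Wspace x (i + 1) ≤ V ↔ rvec (x i) ∈ V ∧ rvec (x (i + 1)) ∈ V := by
  simp [Wspace, Submodule.span_le, Set.insert_subset_iff]

lemma ConsecIn.Wspace_eq {x : ℕ → Fin 4 → ℤ} {i j : ℕ} (hij : ConsecIn (Iset x) i j) :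
    Wspace x (i + 1) = Wspace x j := by
  obtain ⟨hi, -, hlt, hmin⟩ := hij
  have key : ∀ k, i + 1 ≤ k → k ≤ j → Wspace x (i + 1) = Wspace x k := by
    intro k hk
    induction k, hk using Nat.le_induction with
    | base => exact fun _ => rfl
    | succ k hk ih =>
      intro hkj
      rw [ih (by omega)]
      by_contra hne
      have := hmin k ⟨by have := hi.1; omega, hne⟩ (by omega)
      omega
  exact key j hlt le_rfl

namespace IsMinimalSeq

variable {ξ : ℝ} {x : ℕ → Fin 4 → ℤ}

lemma finrank_Wspace_succ (h : IsMinimalSeq ξ x) {i : ℕ} (hi : 1 ≤ i) :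
    Module.finrank ℝ (Wspace x (i + 1)) = 2 :=
  finrank_span_rvec (h.plucker_ne_zero hi)

lemma rvec_notMem_Wspace_add_two (h : IsMinimalSeq ξ x) {i : ℕ} (hi : 1 ≤ i)
    (hI : i + 1 ∈ Iset x) : rvec (x i) ∉ Wspace x (i + 2) := fun hmem =>
  hI.2 (Submodule.eq_of_le_of_finrank_eq
    (Wspace_succ_le_iff.mpr ⟨hmem, rvec_mem_Wspace_succ x (i + 1)⟩)
    ((h.finrank_Wspace_succ hi).trans (h.finrank_Wspace_succ (by omega)).symm))

lemma rvec_add_two_notMem_Wspace (h : IsMinimalSeq ξ x) {i : ℕ} (hi : 1 ≤ i)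
    (hI : i + 1 ∈ Iset x) : rvec (x (i + 2)) ∉ Wspace x (i + 1) := fun hmem =>
  hI.2 (Submodule.eq_of_le_of_finrank_eq
    (Wspace_succ_le_iff.mpr ⟨rvec_mem_Wspace x (i + 1), hmem⟩)
    ((h.finrank_Wspace_succ (by omega)).trans (h.finrank_Wspace_succ hi).symm)).symm

lemma not_recurs_of_mem_Iset (h : IsMinimalSeq ξ x) {i : ℕ} (hi : 1 ≤ i)
    (hI : i + 1 ∈ Iset x) {a : Fin 3 → ℤ} (ha : a ≠ 0) (h1 : Recurs a (x (i + 1)))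
    (h2 : Recurs a (x (i + 2))) : ¬ Recurs a (x i) := fun h0 =>
  hI.2 ((span_eq_recursSpace ha h0 h1 (h.plucker_ne_zero hi)).trans
    (span_eq_recursSpace ha h1 h2 (h.plucker_ne_zero (by omega))).symm)

lemma log_det_nonneg (h : IsMinimalSeq ξ x) {i j : ℕ} (hi : 1 ≤ i)
    (hij : ConsecIn (Iset x) (i + 1) (j + 1)) (hJ : i + 1 ∈ Jset x) :
    0 ≤ Real.log 24 + Real.log (znorm (x (j + 2))) + Real.log (zL ξ (x i))
      + Real.log (zL ξ (x j)) + Real.log (zL ξ (x (j + 1))) := by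
  have hlt : i < j := by have := hij.2.2.1; omega
  have hW : Wspace x (i + 2) = Wspace x (j + 1) := hij.Wspace_eq
  have hU : Uspace x (i + 1) ≠ Uspace x (j + 1) := hJ.2 _ hij
  have hUi : Uspace x (i + 1) = Wspace x (j + 1) ⊔ Submodule.span ℝ {rvec (x i)} := by
    rw [Uspace, ← hW]
    refine le_antisymm (sup_le (Wspace_succ_le_iff.mpr ⟨?_, ?_⟩) le_sup_left)
      (sup_le le_sup_right ?_)
    · exact Submodule.mem_sup_right (Submodule.mem_span_singleton_self _)
    · exact Submodule.mem_sup_left (rvec_mem_Wspace_succ x (i + 1))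
    · rw [Submodule.span_singleton_le_iff_mem]
      exact Submodule.mem_sup_left (rvec_mem_Wspace_succ x i)
  have hUj : Uspace x (j + 1) = Wspace x (j + 1) ⊔ Submodule.span ℝ {rvec (x (j + 2))} := by
    refine le_antisymm (sup_le le_sup_left (Wspace_succ_le_iff.mpr ⟨?_, ?_⟩))
      (sup_le le_sup_left ?_)
    · exact Submodule.mem_sup_left (rvec_mem_Wspace x (j + 1))
    · exact Submodule.mem_sup_right (Submodule.mem_span_singleton_self _)
    · rw [Submodule.span_singleton_le_iff_mem]
      exact Submodule.mem_sup_right (rvec_mem_Wspace x (j + 2))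
  have hdet : (Matrix.of ![x i, x j, x (j + 1), x (j + 2)]).det ≠ 0 :=
    det_ne_zero_of_sup_ne (h.plucker_ne_zero (by omega))
      (fun hz => h.rvec_notMem_Wspace_add_two hi hij.1 (hW.symm ▸ hz))
      (h.rvec_add_two_notMem_Wspace (by omega) hij.2.1) (hUi ▸ hUj ▸ hU)
  have hle := abs_det_le (ξ := ξ) (h.znorm_mono hi (by omega : i ≤ j + 2))
    (h.znorm_mono (by omega) (by omega : j ≤ j + 2))
    (h.znorm_mono (by omega) (by omega : j + 1 ≤ j + 2))
    (h.zL_anti hi (by omega : i ≤ j + 2)) (h.zL_anti (by omega) (by omega : j ≤ j + 2))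
    (h.zL_anti (by omega) (by omega : j + 1 ≤ j + 2))
  have h1 : (1 : ℝ) ≤ |((Matrix.of ![x i, x j, x (j + 1), x (j + 2)]).det : ℝ)| := by
    exact_mod_cast Int.one_le_abs hdet
  have hX : 0 < znorm (x (j + 2)) := zero_lt_one.trans_le (h.one_le_znorm (by omega))
  have hL₁ := h.zL_pos hi
  have hL₂ := h.zL_pos (i := j) (by omega)
  have hL₃ := h.zL_pos (i := j + 1) (by omega)
  have hlog := Real.log_nonneg (h1.trans hle)
  rw [Real.log_mul (by norm_num) (by positivity), Real.log_mul hX.ne' (by positivity),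
    Real.log_mul hL₁.ne' (by positivity), Real.log_mul hL₂.ne' hL₃.ne'] at hlog
  linarith

end IsMinimalSeq

/-! ### The final estimates -/

lemma exponent_sq_lt_two {lam : ℝ} (hlam : √2 - 1 < lam) (hθ : 0 ≤ (1 - lam) / lam) :
    ((1 - lam) / lam) ^ 2 < 2 := by
  have h2 : √2 ^ 2 = 2 := Real.sq_sqrt (by norm_num)
  have h1 : 1 < √2 := Real.lt_sqrt_of_sq_lt (by norm_num)
  have hlt : (1 - lam) / lam < √2 := by
    rw [div_lt_iff₀ (by linarith)]
    nlinarith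
  nlinarith

/-- Points satisfying a common recurrence right after a change of plane have bounded norm. -/
lemma exists_log_znorm_le_of_mem_Iset {ξ c lam : ℝ}
    (hξ : LinearIndependent ℚ ![(1 : ℝ), ξ, ξ ^ 2, ξ ^ 3]) (hc : 0 < c) (hlam : √2 - 1 < lam)
    (hlam' : 1 / 3 < lam) (happrox : ApproxHyp ξ c lam) :
    ∃ B : ℝ, ∀ x, IsMinimalSeq ξ x → ∀ i, 1 ≤ i → i + 1 ∈ Iset x → ∀ a : Fin 3 → ℤ, a ≠ 0 →
      Recurs a (x (i + 1)) → Recurs a (x (i + 2)) → Real.log (znorm (x (i + 1))) ≤ B := by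
  have hlam0 : 0 < lam := by linarith
  obtain ⟨C, hC⟩ := exists_log_zL_le hc hlam0 happrox
  obtain ⟨A, hA⟩ := exists_log_znorm_le_of_hankelCross_eq_zero hc hlam' happrox
  obtain ⟨G, hG⟩ := exists_recurs_or_log_le (ne_zero_of_linearIndependent hξ)
  obtain ⟨P, hP⟩ := exists_log_le_of_not_recurs ξ
  set θ := (1 - lam) / lam with hθ
  have hmul : lam * θ = 1 - lam := by rw [hθ]; field_simp
  set c₁ := (P + 3 * C) / lam with hc₁
  set c₂ := (G + 2 * C) / lam with hc₂
  have hmul₁ : lam * c₁ = P + 3 * C := by rw [hc₁]; field_simp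
  have hmul₂ : lam * c₂ = G + 2 * C := by rw [hc₂]; field_simp
  refine ⟨max A (max (c₁ / 2) ((c₁ + θ * c₂) / (2 - θ ^ 2))), fun x h i hi hI a ha h1 h2 => ?_⟩
  by_cases h0 : hankelCross (x (i + 1)) = 0
  · exact (hA x h i hi h0).trans (le_max_left _ _)
  refine le_trans ?_ (le_max_right _ _)
  have hna := h.not_recurs_of_mem_Iset hi hI ha h1 h2
  have hg := (hG x h i (i + 1) hi (by omega) (rvec_mem_Wspace x (i + 1))).resolve_left
    fun hr => hna (Recurs.of_hankelCross h0 h1 hr.1)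
  have hp := hP x h i hi a ha h1 h2 hna
  have hC₁ := hC x h i hi
  have hC₂ := hC x h (i + 1) (by omega)
  have hn := h.log_nonneg (i := i + 2) (by omega)
  have e₂ : Real.log (znorm (x (i + 2))) ≤ c₂ + θ * Real.log (znorm (x (i + 1))) := by
    refine le_of_mul_le_mul_left ?_ hlam0
    rw [mul_add, ← mul_assoc, hmul, hmul₂]
    linarith
  have e₁ : 2 * Real.log (znorm (x (i + 1))) ≤ c₁ + θ * Real.log (znorm (x (i + 2))) := by
    refine le_of_mul_le_mul_left ?_ hlam0
    rw [mul_add, ← mul_assoc lam θ, hmul, hmul₁]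
    linarith
  rcases le_or_gt 0 θ with hθ0 | hθ0
  · refine le_max_of_le_right ?_
    have := exponent_sq_lt_two hlam hθ0
    rw [le_div_iff₀ (by linarith)]
    nlinarith [mul_le_mul_of_nonneg_left e₂ hθ0]
  · refine le_max_of_le_left ?_
    nlinarith

/-- The two estimates in logarithmic form, with the bounded range set aside. -/
lemma exists_log_le_or_log_le {ξ c lam : ℝ}
    (hξ : LinearIndependent ℚ ![(1 : ℝ), ξ, ξ ^ 2, ξ ^ 3]) (hc : 0 < c) (hlam : √2 - 1 < lam)
    (happrox : ApproxHyp ξ c lam) :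
    ∃ B k : ℝ, ∀ x, IsMinimalSeq ξ x → ∀ i j, 1 ≤ i → ConsecIn (Iset x) (i + 1) (j + 1) →
      Real.log (znorm (x (j + 2))) ≤ B ∨
      (Real.log (znorm (x (j + 2))) ≤ k + (1 - lam) / lam * Real.log (znorm (x (i + 2))) ∧
        (i + 1 ∈ Jset x → Real.log (znorm (x (i + 1))) ≤
          k + (((1 - lam) / lam) ^ 2 - 1) * Real.log (znorm (x (j + 1))))) := by
  have hlam' : 1 / 3 < lam := by
    have : 4 / 3 < √2 := Real.lt_sqrt_of_sq_lt (by norm_num)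
    linarith
  have hlam0 : 0 < lam := by linarith
  obtain ⟨C, hC⟩ := exists_log_zL_le hc hlam0 happrox
  obtain ⟨A, hA⟩ := exists_log_znorm_le_of_hankelCross_eq_zero hc hlam' happrox
  obtain ⟨A', hA'⟩ := exists_log_znorm_succ_le hξ hc hlam0 happrox A
  obtain ⟨G, hG⟩ := exists_recurs_or_log_le (ne_zero_of_linearIndependent hξ)
  obtain ⟨B₁, hB₁⟩ := exists_log_znorm_le_of_mem_Iset hξ hc hlam hlam' happrox
  obtain ⟨B₂, hB₂⟩ := exists_log_znorm_succ_le hξ hc hlam0 happrox B₁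
  obtain ⟨B₃, hB₃⟩ := exists_log_znorm_le_of_recurs hξ B₂
  obtain ⟨B₄, hB₄⟩ := exists_log_znorm_succ_le hξ hc hlam0 happrox B₃
  set θ := (1 - lam) / lam with hθ
  have hmul : lam * θ = 1 - lam := by rw [hθ]; field_simp
  set c₂ := (G + 2 * C) / lam with hc₂
  set c₃ := (Real.log 24 + 3 * C) / lam with hc₃
  have hmul₂ : lam * c₂ = G + 2 * C := by rw [hc₂]; field_simp
  have hmul₃ : lam * c₃ = Real.log 24 + 3 * C := by rw [hc₃]; field_simp
  refine ⟨max A' (max B₄ c₂), max c₂ (c₃ + θ * c₂), fun x h i j hi hij => ?_⟩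
  have hlt : i < j := by have := hij.2.2.1; omega
  have hW : Wspace x (i + 2) = Wspace x (j + 1) := hij.Wspace_eq
  by_cases h0 : hankelCross (x (j + 1)) = 0
  · exact .inl (le_max_of_le_left (hA' x h (j + 1) (by omega) (hA x h j (by omega) h0)))
  by_cases hbad : Recurs (hankelCross (x (j + 1))) (x (i + 1)) ∧
      Recurs (hankelCross (x (j + 1))) (x (i + 2))
  · refine .inl (le_max_of_le_right (le_max_of_le_left (hB₄ x h (j + 1) (by omega) ?_)))
    refine hB₃ x h (i + 1) (j + 1) (by omega) (by omega) _ h0 hbad.1 hbad.2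
      (recurs_hankelCross_self _) (hB₂ x h (i + 1) (by omega) ?_)
    exact hB₁ x h i hi hij.1 _ h0 hbad.1 hbad.2
  have hmem : rvec (x (j + 1)) ∈ Wspace x (i + 2) := hW ▸ rvec_mem_Wspace x (j + 1)
  have hgi := (hG x h (i + 1) (j + 1) (by omega) (by omega) hmem).resolve_left hbad
  have hgj := (hG x h j (j + 1) (by omega) (by omega)
    (rvec_mem_Wspace x (j + 1))).resolve_left fun hr => hbad <| by
      have hle : Wspace x (i + 2) ≤ recursSpace (hankelCross (x (j + 1))) := by
        rw [hW, Wspace_succ_le_iff]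
        exact ⟨rvec_mem_recursSpace.mpr hr.1, rvec_mem_recursSpace.mpr hr.2⟩
      rw [Wspace_succ_le_iff] at hle
      exact ⟨rvec_mem_recursSpace.mp hle.1, rvec_mem_recursSpace.mp hle.2⟩
  have hCi := hC x h i hi
  have hCi' := hC x h (i + 1) (by omega)
  have hCj := hC x h j (by omega)
  have hCj' := hC x h (j + 1) (by omega)
  have ei : Real.log (znorm (x (j + 2))) ≤ c₂ + θ * Real.log (znorm (x (i + 2))) := by
    refine le_of_mul_le_mul_left ?_ hlam0
    rw [mul_add, ← mul_assoc, hmul, hmul₂]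
    linarith
  have ej : Real.log (znorm (x (j + 2))) ≤ c₂ + θ * Real.log (znorm (x (j + 1))) := by
    refine le_of_mul_le_mul_left ?_ hlam0
    rw [mul_add, ← mul_assoc, hmul, hmul₂]
    linarith
  rcases le_or_gt 0 θ with hθ0 | hθ0
  · refine .inr ⟨ei.trans (by gcongr; exact le_max_left _ _), fun hJ => ?_⟩
    have hd := h.log_det_nonneg hi hij hJ
    have ed : Real.log (znorm (x (i + 1))) ≤
        c₃ + θ * Real.log (znorm (x (j + 2))) - Real.log (znorm (x (j + 1))) := by
      refine le_of_mul_le_mul_left ?_ hlam0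
      rw [mul_sub, mul_add, ← mul_assoc, hmul, hmul₃]
      linarith
    have := le_max_right c₂ (c₃ + θ * c₂)
    nlinarith [mul_le_mul_of_nonneg_left ej hθ0]
  · refine .inl (le_max_of_le_right (le_max_of_le_right ?_))
    nlinarith [h.log_nonneg (i := i + 2) (by omega)]

lemma le_exp_mul_rpow_of_log_le {X Y k θ : ℝ} (hX : 0 < X) (hY : 0 < Y)
    (h : Real.log X ≤ k + θ * Real.log Y) : X ≤ Real.exp k * Y ^ θ := by
  rw [Real.rpow_def_of_pos hY, ← Real.exp_add, mul_comm (Real.log Y)]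
  exact (Real.log_le_iff_le_exp hX).mp h

lemma le_add_mul_of_le {B a b t : ℝ} (ha : a ≤ B) (hb0 : 0 ≤ b) (hb : b ≤ B) :
    a ≤ B + |t| * B + t * b := by
  nlinarith [abs_nonneg t, neg_abs_le t, mul_nonneg (abs_nonneg t) (sub_nonneg.mpr hb)]

theorem statement9 (ξ : ℝ)
    (hξ : LinearIndependent ℚ ![(1 : ℝ), ξ, ξ ^ 2, ξ ^ 3])
    (c lam : ℝ) (hc : 0 < c) (hlam : Real.sqrt 2 - 1 < lam)
    (happrox : ApproxHyp ξ c lam) :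
    ∃ κ : ℝ, 0 < κ ∧ ∀ x : ℕ → Fin 4 → ℤ, IsMinimalSeq ξ x →
      ∀ i j : ℕ, ConsecIn (Iset x) i j →
      znorm (x (j + 1)) ≤ κ * znorm (x (i + 1)) ^ ((1 - lam) / lam) ∧
      (i ∈ Jset x →
        znorm (x i) ≤ κ * znorm (x j) ^ (((1 - lam) / lam) ^ 2 - 1)) := by
  obtain ⟨B, k, hBk⟩ := exists_log_le_or_log_le hξ hc hlam happrox
  set θ := (1 - lam) / lam
  set K := max k (max (B + |θ| * B) (B + |θ ^ 2 - 1| * B))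
  refine ⟨Real.exp K, Real.exp_pos K, fun x h i j hij => ?_⟩
  obtain ⟨p, rfl⟩ : ∃ p, i = p + 1 := ⟨i - 1, by have := hij.1.1; omega⟩
  obtain ⟨q, rfl⟩ : ∃ q, j = q + 1 := ⟨j - 1, by have := hij.2.1.1; omega⟩
  have hp : 1 ≤ p := by have := hij.1.1; omega
  have hpq : p < q := by have := hij.2.2.1; omega
  have hpos : ∀ m, 1 ≤ m → 0 < znorm (x m) := fun m hm =>
    zero_lt_one.trans_le (h.one_le_znorm hm)
  have hk : k ≤ K := le_max_left _ _
  have hK₁ : B + |θ| * B ≤ K := (le_max_left _ _).trans (le_max_right _ _)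
  have hK₂ : B + |θ ^ 2 - 1| * B ≤ K := (le_max_right _ _).trans (le_max_right _ _)
  suffices hlog : Real.log (znorm (x (q + 2))) ≤ K + θ * Real.log (znorm (x (p + 2))) ∧
      (p + 1 ∈ Jset x → Real.log (znorm (x (p + 1))) ≤
        K + (θ ^ 2 - 1) * Real.log (znorm (x (q + 1)))) from
    ⟨le_exp_mul_rpow_of_log_le (hpos _ (by omega)) (hpos _ (by omega)) hlog.1,
      fun hJ => le_exp_mul_rpow_of_log_le (hpos _ (by omega)) (hpos _ (by omega)) (hlog.2 hJ)⟩
  rcases hBk x h p q hp hij with hB | ⟨h₁, h₂⟩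
  · have hle : ∀ m, 1 ≤ m → m ≤ q + 2 → Real.log (znorm (x m)) ≤ B := fun m hm hmq =>
      (h.log_mono hm hmq).trans hB
    have e₁ := le_add_mul_of_le (t := θ) hB (h.log_nonneg (i := p + 2) (by omega))
      (hle (p + 2) (by omega) (by omega))
    have e₂ := le_add_mul_of_le (t := θ ^ 2 - 1) (hle (p + 1) (by omega) (by omega))
      (h.log_nonneg (i := q + 1) (by omega)) (hle (q + 1) (by omega) (by omega))
    exact ⟨e₁.trans (by gcongr), fun _ => e₂.trans (by gcongr)⟩
  · exact ⟨h₁.trans (by gcongr), fun hJ => (h₂ hJ).trans (by gcongr)⟩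
end
end

section
/- Let ξ ∈ ℝ. For any x, y, z ∈ ℝ⁴ one has Ψ₋(x,y,z)⁻ = det(x⁻,y⁻,z⁺)y⁻ − det(x⁻,y⁻,z⁻)y⁺ and Ψ₊(x,y,z)⁺ = det(x⁺,y⁺,z⁺)y⁻ − det(x⁺,y⁺,z⁻)y⁺. -/
noncomputable section

/-- x⁻ = (x₀,x₁,x₂). -/
def vm (x : Fin 4 → ℝ) : Fin 3 → ℝ := ![x 0, x 1, x 2]

/-- x⁺ = (x₁,x₂,x₃). -/
def vp (x : Fin 4 → ℝ) : Fin 3 → ℝ := ![x 1, x 2, x 3]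

/-- Determinant of the 3×3 matrix with rows a, b, c. -/
def det3 (a b c : Fin 3 → ℝ) : ℝ := Matrix.det (Matrix.of ![a, b, c])

/-- The map C(x,y) = (det(x⁻,x⁺,y⁻), det(x⁻,x⁺,y⁺)). -/
def Cmap (x y : Fin 4 → ℝ) : Fin 2 → ℝ :=
  ![det3 (vm x) (vp x) (vm y), det3 (vm x) (vp x) (vp y)]

/-- The trilinear map E. -/
def Emap (w x y : Fin 4 → ℝ) : Fin 2 → ℝ :=
  ![det3 (vm w) (vp x) (vm y) - det3 (vp w) (vm x) (vm y),
    det3 (vm w) (vp x) (vp y) - det3 (vp w) (vm x) (vp y)]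

/-- Ψ₋(x,y,z) = C(y,z)⁻x + E(y,z,x)⁻y − C(y,x)⁻z. -/
def PsiM (x y z : Fin 4 → ℝ) : Fin 4 → ℝ :=
  Cmap y z 0 • x + Emap y z x 0 • y - Cmap y x 0 • z

/-- Ψ₊(x,y,z) = C(y,z)⁺x + E(y,z,x)⁺y − C(y,x)⁺z. -/
def PsiP (x y z : Fin 4 → ℝ) : Fin 4 → ℝ :=
  Cmap y z 1 • x + Emap y z x 1 • y - Cmap y x 1 • z

theorem statement10 (ξ : ℝ) (x y z : Fin 4 → ℝ) :
    vm (PsiM x y z)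
      = det3 (vm x) (vm y) (vp z) • vm y - det3 (vm x) (vm y) (vm z) • vp y ∧
    vp (PsiP x y z)
      = det3 (vp x) (vp y) (vp z) • vm y - det3 (vp x) (vp y) (vm z) • vp y := by
  constructor <;> ext i <;> fin_cases i <;>
    simp [vm, vp, PsiM, PsiP, Cmap, Emap, det3, Matrix.det_fin_three] <;> ring
end
end

section
/- Let ξ ∈ ℝ. There exists a constant κ > 0 depending only on ξ such that for any non-zero x, y, z ∈ ℝ⁴ with L(x)/‖x‖ ≥ L(y)/‖y‖ ≥ L(z)/‖z‖ and for any sign ε ∈ {−,+}: ‖Ψ_ε(x,y,z)‖ ≤ κ(‖y‖²L(x)L(z) + ‖z‖L(x)L(y)²) and L(Ψ_ε(x,y,z)) ≤ κ‖z‖L(x)L(y)². -/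
noncomputable section

/-- ‖x‖ = max of the absolute values of the coordinates. -/
def norm4 (x : Fin 4 → ℝ) : ℝ := max (max |x 0| |x 1|) (max |x 2| |x 3|)

/-- L(x) = max_{1≤i≤3}|x₀ξⁱ − x_i|. -/
def L4 (ξ : ℝ) (x : Fin 4 → ℝ) : ℝ :=
  max (max |x 0 * ξ - x 1| |x 0 * ξ ^ 2 - x 2|) |x 0 * ξ ^ 3 - x 3|

lemma det3_eq (a b c : Fin 3 → ℝ) :
    det3 a b c = a 0 * b 1 * c 2 - a 0 * b 2 * c 1 - a 1 * b 0 * c 2 + a 1 * b 2 * c 0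
      + a 2 * b 0 * c 1 - a 2 * b 1 * c 0 := by
  simp [det3, Matrix.det_fin_three]

lemma abs_det3_le {a b c : Fin 3 → ℝ} {A B C : ℝ} (ha : ∀ i, |a i| ≤ A) (hb : ∀ i, |b i| ≤ B)
    (hc : ∀ i, |c i| ≤ C) : |det3 a b c| ≤ 6 * (A * B * C) := by
  have hA : 0 ≤ A := (abs_nonneg _).trans (ha 0)
  have hB : 0 ≤ B := (abs_nonneg _).trans (hb 0)
  have key (i j k : Fin 3) : |a i * b j * c k| ≤ A * B * C := by
    rw [abs_mul, abs_mul]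
    gcongr
    exacts [ha i, hb j, hc k]
  have h (i j k : Fin 3) := abs_le.1 (key i j k)
  rw [det3_eq, abs_le]
  constructor <;> linarith [h 0 1 2, h 0 2 1, h 1 0 2, h 1 2 0, h 2 0 1, h 2 1 0]

lemma abs_mul_det3_le {r R : ℝ} {a b c : Fin 3 → ℝ} {A B C : ℝ} (hr : |r| ≤ R)
    (ha : ∀ i, |a i| ≤ A) (hb : ∀ i, |b i| ≤ B) (hc : ∀ i, |c i| ≤ C) :
    |r * det3 a b c| ≤ R * (6 * (A * B * C)) := by
  rw [abs_mul]
  have := (abs_nonneg r).trans hr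
  gcongr
  exact abs_det3_le ha hb hc

lemma norm4_nonneg (v : Fin 4 → ℝ) : 0 ≤ norm4 v := by simp [norm4]

lemma norm4_pos {v : Fin 4 → ℝ} (hv : v ≠ 0) : 0 < norm4 v := by
  obtain ⟨i, hi⟩ := Function.ne_iff.1 hv
  have hi : 0 < |v i| := abs_pos.2 hi
  fin_cases i <;> simp only [norm4, lt_max_iff] <;> tauto

lemma abs_apply_zero_le_norm4 (v : Fin 4 → ℝ) : |v 0| ≤ norm4 v := by simp [norm4]

lemma L4_nonneg (ξ : ℝ) (v : Fin 4 → ℝ) : 0 ≤ L4 ξ v := by simp [L4]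

lemma abs_sub_le_L4 (ξ : ℝ) (v : Fin 4 → ℝ) :
    |v 1 - ξ * v 0| ≤ L4 ξ v ∧ |v 2 - ξ ^ 2 * v 0| ≤ L4 ξ v ∧ |v 3 - ξ ^ 3 * v 0| ≤ L4 ξ v := by
  simp only [mul_comm (ξ ^ _) (v 0), mul_comm ξ (v 0), abs_sub_comm (v _) _]
  simp [L4]

/-- A bound for the numerical constants that depend on `ξ` only. -/
def xiBound (ξ : ℝ) : ℝ := 1 + |ξ| + |ξ| ^ 2 + |ξ| ^ 3

lemma one_le_xiBound (ξ : ℝ) : 1 ≤ xiBound ξ := by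
  have := abs_nonneg ξ
  have : 0 ≤ |ξ| + |ξ| ^ 2 + |ξ| ^ 3 := by positivity
  unfold xiBound
  linarith

lemma pow_le_xiBound (ξ : ℝ) :
    |ξ| ≤ xiBound ξ ∧ |ξ ^ 2| ≤ xiBound ξ ∧ |ξ ^ 3| ≤ xiBound ξ ∧ 1 + |ξ| ≤ xiBound ξ := by
  have h1 := abs_nonneg ξ
  have h2 := pow_nonneg h1 2
  have h3 := pow_nonneg h1 3
  rw [abs_pow, abs_pow]
  unfold xiBound
  refine ⟨?_, ?_, ?_, ?_⟩ <;> linarith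

lemma L4_le_norm4 (ξ : ℝ) (v : Fin 4 → ℝ) : L4 ξ v ≤ 2 * xiBound ξ * norm4 v := by
  have hK := one_le_xiBound ξ
  have hN := norm4_nonneg v
  obtain ⟨k1, k2, k3, -⟩ := pow_le_xiBound ξ
  have key (p q : ℝ) (hp : |p| ≤ xiBound ξ) (hq : |q| ≤ norm4 v) :
      |v 0 * p - q| ≤ 2 * xiBound ξ * norm4 v := by
    have h1 : |v 0 * p| ≤ norm4 v * xiBound ξ := by
      rw [abs_mul]
      gcongr
      exact abs_apply_zero_le_norm4 v
    have h2 : norm4 v ≤ norm4 v * xiBound ξ := le_mul_of_one_le_right hN hK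
    linarith [abs_sub (v 0 * p) q]
  exact max_le (max_le (key _ _ k1 (by simp [norm4])) (key _ _ k2 (by simp [norm4])))
    (key _ _ k3 (by simp [norm4]))

lemma norm4_le (ξ : ℝ) (v : Fin 4 → ℝ) : norm4 v ≤ xiBound ξ * (|v 0| + L4 ξ v) := by
  have hK := one_le_xiBound ξ
  have h0 := abs_nonneg (v 0)
  have hL := L4_nonneg ξ v
  obtain ⟨k1, k2, k3, -⟩ := pow_le_xiBound ξ
  obtain ⟨l1, l2, l3⟩ := abs_sub_le_L4 ξ v
  have hL' : L4 ξ v ≤ xiBound ξ * L4 ξ v := le_mul_of_one_le_left hL hK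
  have key (p q : ℝ) (hp : |p| ≤ xiBound ξ) (hq : |q - p * v 0| ≤ L4 ξ v) :
      |q| ≤ xiBound ξ * (|v 0| + L4 ξ v) := by
    have h1 : |p * v 0| ≤ xiBound ξ * |v 0| := by
      rw [abs_mul]
      gcongr
    have h2 := abs_add_le (q - p * v 0) (p * v 0)
    rw [sub_add_cancel] at h2
    linarith
  refine max_le (max_le ?_ (key _ _ k1 l1)) (max_le (key _ _ k2 l2) (key _ _ k3 l3))
  nlinarith

lemma L4_combination_le (ξ p q r : ℝ) (x y z : Fin 4 → ℝ) :
    L4 ξ (p • x + q • y - r • z) ≤ |p| * L4 ξ x + |q| * L4 ξ y + |r| * L4 ξ z := by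
  have key (a b c : ℝ) (ha : |a| ≤ L4 ξ x) (hb : |b| ≤ L4 ξ y) (hc : |c| ≤ L4 ξ z) (d : ℝ)
      (hd : d = p * a + q * b - r * c) : |d| ≤ |p| * L4 ξ x + |q| * L4 ξ y + |r| * L4 ξ z := by
    rw [hd]
    refine ((abs_sub _ _).trans (add_le_add_left (abs_add_le _ _) _)).trans ?_
    rw [abs_mul, abs_mul, abs_mul]
    gcongr
  refine max_le (max_le ?_ ?_) ?_
  · refine key (x 0 * ξ - x 1) (y 0 * ξ - y 1) (z 0 * ξ - z 1) (by simp [L4]) (by simp [L4])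
      (by simp [L4]) _ ?_
    simp
    ring
  · refine key (x 0 * ξ ^ 2 - x 2) (y 0 * ξ ^ 2 - y 2) (z 0 * ξ ^ 2 - z 2) (by simp [L4])
      (by simp [L4]) (by simp [L4]) _ ?_
    simp
    ring
  · refine key (x 0 * ξ ^ 3 - x 3) (y 0 * ξ ^ 3 - y 3) (z 0 * ξ ^ 3 - z 3) (by simp [L4])
      (by simp [L4]) (by simp [L4]) _ ?_
    simp
    ring

/-- The point `(1, ξ, ξ²)`. -/
def veronese (ξ : ℝ) : Fin 3 → ℝ := ![1, ξ, ξ ^ 2]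

/-- The error term `x⁻ - x₀ (1, ξ, ξ²)`. -/
def vmErr (ξ : ℝ) (v : Fin 4 → ℝ) : Fin 3 → ℝ := vm v - v 0 • veronese ξ

/-- The error term `x⁺ - x₀ ξ (1, ξ, ξ²)`. -/
def vpErr (ξ : ℝ) (v : Fin 4 → ℝ) : Fin 3 → ℝ := vp v - v 0 • ξ • veronese ξ

/-- The difference `x⁺ - ξ x⁻`. -/
def shiftDiff (ξ : ℝ) (v : Fin 4 → ℝ) : Fin 3 → ℝ := vp v - ξ • vm v

lemma abs_veronese_le (ξ : ℝ) (i : Fin 3) : |veronese ξ i| ≤ xiBound ξ := by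
  have hK := one_le_xiBound ξ
  obtain ⟨k1, k2, -, -⟩ := pow_le_xiBound ξ
  fin_cases i
  · simpa [veronese] using hK
  · simpa [veronese] using k1
  · exact k2

lemma abs_smul_veronese_le (ξ : ℝ) (i : Fin 3) : |(ξ • veronese ξ) i| ≤ xiBound ξ := by
  obtain ⟨k1, k2, k3, -⟩ := pow_le_xiBound ξ
  fin_cases i
  · simpa [veronese] using k1
  · convert k2 using 2
    simp [veronese]
    ring
  · convert k3 using 2
    simp [veronese]
    ring

lemma L4_le_xiBound_mul (ξ : ℝ) (v : Fin 4 → ℝ) : L4 ξ v ≤ xiBound ξ * L4 ξ v :=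
  le_mul_of_one_le_left (L4_nonneg ξ v) (one_le_xiBound ξ)

lemma abs_vmErr_le (ξ : ℝ) (v : Fin 4 → ℝ) (i : Fin 3) :
    |vmErr ξ v i| ≤ xiBound ξ * L4 ξ v := by
  refine le_trans ?_ (L4_le_xiBound_mul ξ v)
  obtain ⟨l1, l2, -⟩ := abs_sub_le_L4 ξ v
  fin_cases i
  · simpa [vmErr, vm, veronese] using L4_nonneg ξ v
  · refine le_of_eq_of_le (congrArg abs ?_) l1
    simp [vmErr, vm, veronese]
    ring
  · refine le_of_eq_of_le (congrArg abs ?_) l2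
    simp [vmErr, vm, veronese]
    ring

lemma abs_vpErr_le (ξ : ℝ) (v : Fin 4 → ℝ) (i : Fin 3) :
    |vpErr ξ v i| ≤ xiBound ξ * L4 ξ v := by
  refine le_trans ?_ (L4_le_xiBound_mul ξ v)
  obtain ⟨l1, l2, l3⟩ := abs_sub_le_L4 ξ v
  fin_cases i
  · refine le_of_eq_of_le (congrArg abs ?_) l1
    simp [vpErr, vp, veronese]
    ring
  · refine le_of_eq_of_le (congrArg abs ?_) l2
    simp [vpErr, vp, veronese]
    ring
  · refine le_of_eq_of_le (congrArg abs ?_) l3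
    simp [vpErr, vp, veronese]
    ring

lemma abs_shiftDiff_le (ξ : ℝ) (v : Fin 4 → ℝ) (i : Fin 3) :
    |shiftDiff ξ v i| ≤ xiBound ξ * L4 ξ v := by
  obtain ⟨l1, l2, l3⟩ := abs_sub_le_L4 ξ v
  have hL := L4_nonneg ξ v
  have hK : (1 + |ξ|) * L4 ξ v ≤ xiBound ξ * L4 ξ v := by
    gcongr
    exact (pow_le_xiBound ξ).2.2.2
  have key (a b : ℝ) (ha : |a| ≤ L4 ξ v) (hb : |b| ≤ L4 ξ v) :
      |a - ξ * b| ≤ xiBound ξ * L4 ξ v := by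
    have h1 : |ξ * b| ≤ |ξ| * L4 ξ v := by
      rw [abs_mul]
      gcongr
    linarith [abs_sub a (ξ * b)]
  fin_cases i
  · simpa [shiftDiff, vm, vp] using l1.trans (L4_le_xiBound_mul ξ v)
  · convert key _ _ l2 l1 using 2
    simp [shiftDiff, vm, vp]
    ring
  · convert key _ _ l3 l2 using 2
    simp [shiftDiff, vm, vp]
    ring

section Estimates

/-! In this section the third rows of the determinants are `w v = v₀ τ + c v`, with `τ` bounded and
`c v` of the order of `L(v)`: this covers both `w v = v⁻` and `w v = v⁺`. -/

variable {ξ s : ℝ} {w c : (Fin 4 → ℝ) → Fin 3 → ℝ}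

lemma det3_vm_vp_eq (hw : ∀ v, w v = v 0 • s • veronese ξ + c v) (y z : Fin 4 → ℝ) :
    det3 (vm y) (vp y) (w z) =
      y 0 * det3 (veronese ξ) (shiftDiff ξ y) (c z)
      + z 0 * det3 (vmErr ξ y) (shiftDiff ξ y) (s • veronese ξ)
      + det3 (vmErr ξ y) (shiftDiff ξ y) (c z) := by
  simp only [hw, det3_eq, vmErr, shiftDiff, veronese, Pi.add_apply, Pi.sub_apply, Pi.smul_apply,
    smul_eq_mul, Matrix.cons_val]
  ring

lemma det3_polar_eq (hw : ∀ v, w v = v 0 • s • veronese ξ + c v) (x y z : Fin 4 → ℝ) :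
    det3 (vm y) (vp z) (w x) - det3 (vp y) (vm z) (w x) =
      y 0 * det3 (veronese ξ) (shiftDiff ξ z) (c x)
      + x 0 * det3 (vmErr ξ y) (shiftDiff ξ z) (s • veronese ξ)
      + det3 (vmErr ξ y) (shiftDiff ξ z) (c x)
      + z 0 * det3 (veronese ξ) (shiftDiff ξ y) (c x)
      - x 0 * det3 (shiftDiff ξ y) (vmErr ξ z) (s • veronese ξ)
      - det3 (shiftDiff ξ y) (vmErr ξ z) (c x) := by
  simp only [hw, det3_eq, vmErr, shiftDiff, veronese, Pi.add_apply, Pi.sub_apply, Pi.smul_apply,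
    smul_eq_mul, Matrix.cons_val]
  ring

lemma abs_det3_vm_vp_le
    (hτ : ∀ i, |(s • veronese ξ) i| ≤ xiBound ξ) (hc : ∀ v i, |c v i| ≤ xiBound ξ * L4 ξ v)
    (hw : ∀ v, w v = v 0 • s • veronese ξ + c v) (y z : Fin 4 → ℝ) :
    |det3 (vm y) (vp y) (w z)| ≤ 6 * xiBound ξ ^ 3 *
      (norm4 y * L4 ξ y * L4 ξ z + norm4 z * L4 ξ y ^ 2 + L4 ξ y ^ 2 * L4 ξ z) := by
  have h1 := abs_le.1 <| abs_mul_det3_le (abs_apply_zero_le_norm4 y) (abs_veronese_le ξ)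
    (abs_shiftDiff_le ξ y) (hc z)
  have h2 := abs_le.1 <| abs_mul_det3_le (abs_apply_zero_le_norm4 z) (abs_vmErr_le ξ y)
    (abs_shiftDiff_le ξ y) hτ
  have h3 := abs_le.1 <| abs_det3_le (abs_vmErr_le ξ y) (abs_shiftDiff_le ξ y) (hc z)
  rw [det3_vm_vp_eq hw, abs_le]
  constructor <;> linarith

lemma abs_det3_polar_le
    (hτ : ∀ i, |(s • veronese ξ) i| ≤ xiBound ξ) (hc : ∀ v i, |c v i| ≤ xiBound ξ * L4 ξ v)
    (hw : ∀ v, w v = v 0 • s • veronese ξ + c v) (x y z : Fin 4 → ℝ) :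
    |det3 (vm y) (vp z) (w x) - det3 (vp y) (vm z) (w x)| ≤ 6 * xiBound ξ ^ 3 *
      (norm4 y * L4 ξ z * L4 ξ x + 2 * (norm4 x * L4 ξ y * L4 ξ z)
        + 2 * (L4 ξ x * L4 ξ y * L4 ξ z) + norm4 z * L4 ξ y * L4 ξ x) := by
  have h1 := abs_le.1 <| abs_mul_det3_le (abs_apply_zero_le_norm4 y) (abs_veronese_le ξ)
    (abs_shiftDiff_le ξ z) (hc x)
  have h2 := abs_le.1 <| abs_mul_det3_le (abs_apply_zero_le_norm4 x) (abs_vmErr_le ξ y)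
    (abs_shiftDiff_le ξ z) hτ
  have h3 := abs_le.1 <| abs_det3_le (abs_vmErr_le ξ y) (abs_shiftDiff_le ξ z) (hc x)
  have h4 := abs_le.1 <| abs_mul_det3_le (abs_apply_zero_le_norm4 z) (abs_veronese_le ξ)
    (abs_shiftDiff_le ξ y) (hc x)
  have h5 := abs_le.1 <| abs_mul_det3_le (abs_apply_zero_le_norm4 x) (abs_shiftDiff_le ξ y)
    (abs_vmErr_le ξ z) hτ
  have h6 := abs_le.1 <| abs_det3_le (abs_shiftDiff_le ξ y) (abs_vmErr_le ξ z) (hc x)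
  rw [det3_polar_eq hw, abs_le]
  constructor <;> linarith

/-- The terms in `x₀ z₀` and `y₀ z₀` of the first coordinate of `Ψ` cancel. -/
lemma abs_first_coord_le
    (hτ : ∀ i, |(s • veronese ξ) i| ≤ xiBound ξ) (hc : ∀ v i, |c v i| ≤ xiBound ξ * L4 ξ v)
    (hw : ∀ v, w v = v 0 • s • veronese ξ + c v) (x y z : Fin 4 → ℝ) :
    |det3 (vm y) (vp y) (w z) * x 0
      + (det3 (vm y) (vp z) (w x) - det3 (vp y) (vm z) (w x)) * y 0
      - det3 (vm y) (vp y) (w x) * z 0| ≤ 6 * xiBound ξ ^ 3 *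
      (3 * (norm4 x * norm4 y * L4 ξ y * L4 ξ z) + norm4 x * L4 ξ y ^ 2 * L4 ξ z
        + norm4 y ^ 2 * L4 ξ x * L4 ξ z + 2 * (norm4 y * L4 ξ x * L4 ξ y * L4 ξ z)
        + norm4 z * L4 ξ x * L4 ξ y ^ 2) := by
  have hx := abs_apply_zero_le_norm4 x
  have hy := abs_apply_zero_le_norm4 y
  have hz := abs_apply_zero_le_norm4 z
  have hxy : |x 0 * y 0| ≤ norm4 x * norm4 y := by
    rw [abs_mul]
    have := norm4_nonneg x
    gcongr
  have hyy : |y 0 * y 0| ≤ norm4 y * norm4 y := by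
    rw [abs_mul]
    have := norm4_nonneg y
    gcongr
  have h1 := abs_le.1 <| abs_mul_det3_le hxy (abs_veronese_le ξ) (abs_shiftDiff_le ξ y) (hc z)
  have h2 := abs_le.1 <| abs_mul_det3_le hxy (abs_vmErr_le ξ y) (abs_shiftDiff_le ξ z) hτ
  have h3 := abs_le.1 <| abs_mul_det3_le hxy (abs_shiftDiff_le ξ y) (abs_vmErr_le ξ z) hτ
  have h4 := abs_le.1 <| abs_mul_det3_le hx (abs_vmErr_le ξ y) (abs_shiftDiff_le ξ y) (hc z)
  have h5 := abs_le.1 <| abs_mul_det3_le hyy (abs_veronese_le ξ) (abs_shiftDiff_le ξ z) (hc x)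
  have h6 := abs_le.1 <| abs_mul_det3_le hy (abs_vmErr_le ξ y) (abs_shiftDiff_le ξ z) (hc x)
  have h7 := abs_le.1 <| abs_mul_det3_le hy (abs_shiftDiff_le ξ y) (abs_vmErr_le ξ z) (hc x)
  have h8 := abs_le.1 <| abs_mul_det3_le hz (abs_vmErr_le ξ y) (abs_shiftDiff_le ξ y) (hc x)
  rw [det3_vm_vp_eq hw, det3_vm_vp_eq hw, det3_polar_eq hw, abs_le]
  constructor <;> linarith

lemma psi_bounds
    (hτ : ∀ i, |(s • veronese ξ) i| ≤ xiBound ξ) (hc : ∀ v i, |c v i| ≤ xiBound ξ * L4 ξ v)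
    (hw : ∀ v, w v = v 0 • s • veronese ξ + c v) {x y z : Fin 4 → ℝ}
    (hxy : L4 ξ y * norm4 x ≤ L4 ξ x * norm4 y) (hyz : L4 ξ z * norm4 y ≤ L4 ξ y * norm4 z)
    (hxz : L4 ξ z * norm4 x ≤ L4 ξ x * norm4 z) {ψ : Fin 4 → ℝ}
    (hψ : ψ = det3 (vm y) (vp y) (w z) • x
      + (det3 (vm y) (vp z) (w x) - det3 (vp y) (vm z) (w x)) • y
      - det3 (vm y) (vp y) (w x) • z) :
    |ψ 0| ≤ 24 * xiBound ξ ^ 3 *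
      (norm4 y ^ 2 * L4 ξ x * L4 ξ z + norm4 z * L4 ξ x * L4 ξ y ^ 2) ∧
    L4 ξ ψ ≤ 96 * xiBound ξ ^ 4 * (norm4 z * L4 ξ x * L4 ξ y ^ 2) := by
  have hLx := L4_nonneg ξ x
  have hLy := L4_nonneg ξ y
  have hLz := L4_nonneg ξ z
  have hY := norm4_nonneg y
  have hZ := norm4_nonneg z
  have hK := one_le_xiBound ξ
  have hLZ := L4_le_norm4 ξ z
  have hLY := L4_le_norm4 ξ y
  set K := xiBound ξ
  have hq : 0 ≤ 6 * K ^ 3 := by positivity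
  constructor
  · have h0 := abs_first_coord_le hτ hc hw x y z
    have hψ0 : ψ 0 = det3 (vm y) (vp y) (w z) * x 0
      + (det3 (vm y) (vp z) (w x) - det3 (vp y) (vm z) (w x)) * y 0
      - det3 (vm y) (vp y) (w x) * z 0 := by simp [hψ]
    rw [hψ0]
    refine h0.trans ?_
    have e1 := mul_le_mul_of_nonneg_right hxy (mul_nonneg hY hLz)
    have e2 := mul_le_mul_of_nonneg_right hxy (mul_nonneg hLy hLz)
    have e3 := mul_le_mul_of_nonneg_right hyz (mul_nonneg hLx hLy)
    calc _ ≤ 6 * K ^ 3 *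
          (4 * (norm4 y ^ 2 * L4 ξ x * L4 ξ z + norm4 z * L4 ξ x * L4 ξ y ^ 2)) := by
          refine mul_le_mul_of_nonneg_left ?_ hq
          linarith
      _ = _ := by ring
  · have hC : |det3 (vm y) (vp y) (w z)| ≤ 6 * K ^ 3 * (4 * K * (norm4 z * L4 ξ y ^ 2)) := by
      refine (abs_det3_vm_vp_le hτ hc hw y z).trans (mul_le_mul_of_nonneg_left ?_ hq)
      have e1 := mul_le_mul_of_nonneg_right hyz hLy
      have e2 := mul_le_mul_of_nonneg_right hLZ (pow_nonneg hLy 2)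
      have e3 := mul_le_mul_of_nonneg_right hK (mul_nonneg hZ (pow_nonneg hLy 2))
      linarith
    have hE : |det3 (vm y) (vp z) (w x) - det3 (vp y) (vm z) (w x)|
        ≤ 6 * K ^ 3 * (8 * K * (norm4 z * L4 ξ x * L4 ξ y)) := by
      refine (abs_det3_polar_le hτ hc hw x y z).trans (mul_le_mul_of_nonneg_left ?_ hq)
      have e1 := mul_le_mul_of_nonneg_right hyz hLx
      have e2 := mul_le_mul_of_nonneg_right hxz hLy
      have e3 := mul_le_mul_of_nonneg_right hLZ (mul_nonneg hLx hLy)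
      have e4 := mul_le_mul_of_nonneg_right hK (mul_nonneg hZ (mul_nonneg hLx hLy))
      linarith
    have hC' : |det3 (vm y) (vp y) (w x)| ≤ 6 * K ^ 3 * (4 * K * (norm4 y * L4 ξ x * L4 ξ y)) := by
      refine (abs_det3_vm_vp_le hτ hc hw y x).trans (mul_le_mul_of_nonneg_left ?_ hq)
      have e1 := mul_le_mul_of_nonneg_right hxy hLy
      have e2 := mul_le_mul_of_nonneg_right hLY (mul_nonneg hLx hLy)
      have e3 := mul_le_mul_of_nonneg_right hK (mul_nonneg hY (mul_nonneg hLx hLy))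
      linarith
    rw [hψ]
    refine (L4_combination_le ξ _ _ _ x y z).trans ?_
    have f1 := mul_le_mul_of_nonneg_right hC hLx
    have f2 := mul_le_mul_of_nonneg_right hE hLy
    have f3 := mul_le_mul_of_nonneg_right hC' hLz
    have f4 := mul_le_mul_of_nonneg_left hyz
      (show 0 ≤ 24 * K ^ 4 * (L4 ξ x * L4 ξ y) by positivity)
    linarith

end Estimates

theorem statement12 (ξ : ℝ) :
    ∃ κ : ℝ, 0 < κ ∧
      ∀ x y z : Fin 4 → ℝ, x ≠ 0 → y ≠ 0 → z ≠ 0 →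
        L4 ξ y / norm4 y ≤ L4 ξ x / norm4 x →
        L4 ξ z / norm4 z ≤ L4 ξ y / norm4 y →
        ∀ ψ ∈ ({PsiM x y z, PsiP x y z} : Set (Fin 4 → ℝ)),
          norm4 ψ ≤ κ * (norm4 y ^ 2 * L4 ξ x * L4 ξ z
              + norm4 z * L4 ξ x * L4 ξ y ^ 2) ∧
          L4 ξ ψ ≤ κ * (norm4 z * L4 ξ x * L4 ξ y ^ 2) := by
  have hK := one_le_xiBound ξ
  refine ⟨120 * xiBound ξ ^ 5, by positivity, fun x y z hx hy hz hxy hyz ψ hψ => ?_⟩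
  have hxz := hyz.trans hxy
  rw [div_le_div_iff₀ (norm4_pos ‹_›) (norm4_pos ‹_›)] at hxy hyz hxz
  have key : |ψ 0| ≤ 24 * xiBound ξ ^ 3 *
      (norm4 y ^ 2 * L4 ξ x * L4 ξ z + norm4 z * L4 ξ x * L4 ξ y ^ 2) ∧
      L4 ξ ψ ≤ 96 * xiBound ξ ^ 4 * (norm4 z * L4 ξ x * L4 ξ y ^ 2) := by
    rcases hψ with rfl | rfl
    · exact psi_bounds (s := 1) (w := vm) (c := vmErr ξ) (by simpa using abs_veronese_le ξ)
        (abs_vmErr_le ξ) (fun v => by simp [vmErr]) hxy hyz hxz rfl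
    · exact psi_bounds (s := ξ) (w := vp) (c := vpErr ξ) (abs_smul_veronese_le ξ)
        (abs_vpErr_le ξ) (fun v => by simp [vpErr]) hxy hyz hxz rfl
  obtain ⟨h0, hL⟩ := key
  have hN := norm4_le ξ ψ
  have hA : 0 ≤ norm4 y ^ 2 * L4 ξ x * L4 ξ z :=
    mul_nonneg (mul_nonneg (sq_nonneg _) (L4_nonneg ξ x)) (L4_nonneg ξ z)
  have hB : 0 ≤ norm4 z * L4 ξ x * L4 ξ y ^ 2 :=
    mul_nonneg (mul_nonneg (norm4_nonneg z) (L4_nonneg ξ x)) (sq_nonneg _)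
  generalize norm4 y ^ 2 * L4 ξ x * L4 ξ z = A at *
  generalize norm4 z * L4 ξ x * L4 ξ y ^ 2 = B at *
  set K := xiBound ξ
  have h34 : K ^ 3 ≤ K ^ 4 := pow_le_pow_right₀ hK (by norm_num)
  have h45 : K ^ 4 ≤ K ^ 5 := pow_le_pow_right₀ hK (by norm_num)
  have hK5 : 0 ≤ K ^ 5 := by positivity
  constructor
  · calc norm4 ψ ≤ K * (|ψ 0| + L4 ξ ψ) := hN
      _ ≤ K * (24 * K ^ 4 * (A + B) + 96 * K ^ 4 * (A + B)) := by
          gcongr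
          · exact h0.trans (by gcongr)
          · exact hL.trans (by gcongr; linarith)
      _ = 120 * K ^ 5 * (A + B) := by ring
  · refine hL.trans ?_
    gcongr
    norm_num
end
end

section
/- Let ξ ∈ ℝ. Let (v, w, x, y) be a basis of ℝ⁴ with x⁻ and x⁺ linearly independent in ℝ³, and let z = ay + bx + cw for some a, b, c ∈ ℝ. Suppose that det(v, w, x, Ψ_ε(x,y,z)) = 0 for both signs ε ∈ {−,+}. Then there exists t ∈ ℝ such that (i) C(y,z) = t·C(x,y), (ii) C(z,y) = ct·C(x,w), and (iii) det(C(z,x), C(x,w)) = c²·det(C(w,x), C(x,w)). -/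
noncomputable section

/-- Determinant of the 2×2 matrix with rows a, b. -/
def det2 (a b : Fin 2 → ℝ) : ℝ := Matrix.det (Matrix.of ![a, b])

/-- Determinant of the 4×4 matrix with rows a, b, c, d. -/
def det4 (a b c d : Fin 4 → ℝ) : ℝ := Matrix.det (Matrix.of ![a, b, c, d])

/-- The determinant of three vectors given by their coordinates in terms of `e, f, n`. -/
lemma det3_combination (e f n : Fin 3 → ℝ) (p q r p' q' r' p'' q'' r'' : ℝ) :
    det3 (p • e + q • f + r • n) (p' • e + q' • f + r' • n) (p'' • e + q'' • f + r'' • n) =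
      (p * (q' * r'' - r' * q'') - q * (p' * r'' - r' * p'') + r * (p' * q'' - q' * p'')) *
        det3 e f n := by
  simp [det3, Matrix.det_fin_three]
  ring

lemma det2_apply (u u' : Fin 2 → ℝ) : det2 u u' = u 0 * u' 1 - u 1 * u' 0 := by
  simp [det2, Matrix.det_fin_two]

/-- Modulo `w` and `x`, the vector `k x + l y - m (a y + b x + c w)` is `(l - m a) y`. -/
lemma det4_combination (v w x y : Fin 4 → ℝ) (a b c k l m : ℝ) :
    det4 v w x (k • x + l • y - m • (a • y + b • x + c • w)) = (l - m * a) * det4 v w x y := by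
  simp [det4, Matrix.det_succ_row_zero, Fin.sum_univ_succ, Fin.succAbove]
  ring

lemma det4_ne_zero {v w x y : Fin 4 → ℝ} (h : LinearIndependent ℝ ![v, w, x, y]) :
    det4 v w x y ≠ 0 :=
  ((Matrix.isUnit_iff_isUnit_det _).1 (Matrix.linearIndependent_rows_iff_isUnit
    (A := Matrix.of ![v, w, x, y]) |>.1 h)).ne_zero

lemma vm_combination (x y w : Fin 4 → ℝ) (a b c : ℝ) :
    vm (a • y + b • x + c • w) = a • vm y + b • vm x + c • vm w := by
  ext i; fin_cases i <;> simp [vm]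

lemma vp_combination (x y w : Fin 4 → ℝ) (a b c : ℝ) :
    vp (a • y + b • x + c • w) = a • vp y + b • vp x + c • vp w := by
  ext i; fin_cases i <;> simp [vp]

/-- Two independent vectors of `ℝ³` can be completed to a basis. -/
lemma exists_forall_eq_combination {e f : Fin 3 → ℝ} (h : LinearIndependent ℝ ![e, f]) :
    ∃ n : Fin 3 → ℝ, ∀ u : Fin 3 → ℝ, ∃ p q r : ℝ, u = p • e + q • f + r • n := by
  obtain ⟨n, hn⟩ := exists_linearIndependent_snoc_of_lt_finrank h (by simp)
  refine ⟨n, fun u => ?_⟩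
  have hu : u ∈ Submodule.span ℝ (Set.range (Fin.snoc ![e, f] n : Fin 3 → Fin 3 → ℝ)) := by
    rw [hn.span_eq_top_of_card_eq_finrank (by simp)]
    trivial
  obtain ⟨k, hk⟩ := (Submodule.mem_span_range_iff_exists_fun ℝ).1 hu
  refine ⟨k 0, k 1, k 2, ?_⟩
  rw [← hk, Fin.sum_univ_three]
  rfl

theorem statement14 (ξ : ℝ) (v w x y : Fin 4 → ℝ)
    (hbasis₁ : LinearIndependent ℝ ![v, w, x, y])
    (hbasis₂ : Submodule.span ℝ (Set.range ![v, w, x, y]) = ⊤)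
    (hx : LinearIndependent ℝ ![vm x, vp x])
    (a b c : ℝ) (z : Fin 4 → ℝ) (hz : z = a • y + b • x + c • w)
    (hm : det4 v w x (PsiM x y z) = 0)
    (hp : det4 v w x (PsiP x y z) = 0) :
    ∃ t : ℝ,
      Cmap y z = t • Cmap x y ∧
      Cmap z y = (c * t) • Cmap x w ∧
      det2 (Cmap z x) (Cmap x w) = c ^ 2 * det2 (Cmap w x) (Cmap x w) := by
  obtain ⟨n, hn⟩ := exists_forall_eq_combination hx
  obtain ⟨p, q, α, hym⟩ := hn (vm y)
  obtain ⟨r, s, β, hyp⟩ := hn (vp y)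
  obtain ⟨p', q', α', hwm⟩ := hn (vm w)
  obtain ⟨r', s', β', hwp⟩ := hn (vp w)
  set e := vm x with he
  set f := vp x with hf
  have hxm : vm x = (1 : ℝ) • e + (0 : ℝ) • f + (0 : ℝ) • n := by simp [he]
  have hxp : vp x = (0 : ℝ) • e + (1 : ℝ) • f + (0 : ℝ) • n := by simp [hf]
  have hzm : vm z = (a * p + b + c * p') • e + (a * q + c * q') • f +
      (a * α + c * α') • n := by
    rw [hz, vm_combination, hym, hwm, ← he]
    module
  have hzp : vp z = (a * r + c * r') • e + (a * s + b + c * s') • f +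
      (a * β + c * β') • n := by
    rw [hz, vp_combination, hyp, hwp, ← hf]
    module
  have hD := det4_ne_zero hbasis₁
  have hm' : Emap y z x 0 - Cmap y x 0 * a = 0 := by
    have := det4_combination v w x y a b c (Cmap y z 0) (Emap y z x 0) (Cmap y x 0)
    rw [← hz] at this
    exact (mul_eq_zero.1 (this.symm.trans hm)).resolve_right hD
  have hp' : Emap y z x 1 - Cmap y x 1 * a = 0 := by
    have := det4_combination v w x y a b c (Cmap y z 1) (Emap y z x 1) (Cmap y x 1)
    rw [← hz] at this
    exact (mul_eq_zero.1 (this.symm.trans hp)).resolve_right hD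
  clear_value e f
  clear hm hp hz hbasis₁ hbasis₂ hx hn hD he hf
  simp only [Emap, Cmap, hxm, hxp, hym, hyp, hzm, hzp, det3_combination,
    Matrix.cons_val_zero, Matrix.cons_val_one] at hm' hp'
  refine ⟨a * (p * s - q * r) - (p * (a * s + b + c * s') + s * (a * p + b + c * p') -
    q * (a * r + c * r') - r * (a * q + c * q')), ?_, ?_, ?_⟩
  · ext i
    fin_cases i <;>
      simp only [Cmap, hxm, hxp, hym, hyp, hzm, hzp, det3_combination, Fin.zero_eta, Fin.mk_one,
        Matrix.cons_val_zero, Matrix.cons_val_one, Pi.smul_apply, smul_eq_mul]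
    · linear_combination (-p) * hm' - q * hp'
    · linear_combination (-r) * hm' - s * hp'
  · ext i
    fin_cases i <;>
      simp only [Cmap, hxm, hxp, hym, hyp, hzm, hzp, hwm, hwp, det3_combination, Fin.zero_eta,
        Fin.mk_one, Matrix.cons_val_zero, Matrix.cons_val_one, Pi.smul_apply, smul_eq_mul]
    · linear_combination (-(b + c * p')) * hm' - c * q' * hp'
    · linear_combination (-(c * r')) * hm' - (b + c * s') * hp'
  · simp only [det2_apply, Cmap, hxm, hxp, hzm, hzp, hwm, hwp, det3_combination,
      Matrix.cons_val_zero, Matrix.cons_val_one]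
    linear_combination a * det3 e f n * (β' * hm' - α' * hp')
end
end
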